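/- arXiv:1808.08365 — 2 statements merged into one kernel-verified Lean document; each statement's English description precedes it below -/
import Mathlib

section
/- Let n ≥ 2 be an integer and α ∈ [0,1). Let ℰ0, ℰ1 : [0,1) → ℂ satisfy the data assumptions. If ℰ and ℰ̃ are two C^n-solutions of the Goursat problem for the hyperbolic Ernst equation in D (with data {ℰ0, ℰ1} and {ℰ̃0, ℰ̃1} respectively, both data sets satisfying the data assumptions), and if (x,y) ∈ D is such that ℰ0(x') = ℰ̃0(x') for all x' ∈ [0,x] and ℰ1(y') = ℰ̃1(y') for all y' ∈ [0,y], then ℰ(x,y) = ℰ̃(x,y). In particular, the C^n-solution of the Goursat problem with given data is unique if it exists. -/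
open Complex Set MeasureTheory Topology Filter ComplexConjugate

noncomputable section

/-- The triangle `D = {(x,y) : 0 ≤ x, 0 ≤ y, x + y < 1}`. -/
def TriD : Set (ℝ × ℝ) := {p | 0 ≤ p.1 ∧ 0 ≤ p.2 ∧ p.1 + p.2 < 1}

/-- Partial derivative in the first variable. -/
def pdx (f : ℝ → ℝ → ℂ) (x y : ℝ) : ℂ := deriv (fun t => f t y) x

/-- Partial derivative in the second variable. -/
def pdy (f : ℝ → ℝ → ℂ) (x y : ℝ) : ℂ := deriv (fun t => f x t) y

/-- Mixed second partial derivative. -/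
def pdxy (f : ℝ → ℝ → ℂ) (x y : ℝ) : ℂ := pdx (fun a b => pdy f a b) x y

/-- Partial derivative in the first variable (real valued). -/
def pdxR (f : ℝ → ℝ → ℝ) (x y : ℝ) : ℝ := deriv (fun t => f t y) x

/-- Partial derivative in the second variable (real valued). -/
def pdyR (f : ℝ → ℝ → ℝ) (x y : ℝ) : ℝ := deriv (fun t => f x t) y

/-- Mixed second partial derivative (real valued). -/
def pdxyR (f : ℝ → ℝ → ℝ) (x y : ℝ) : ℝ := pdxR (fun a b => pdyR f a b) x y

/-- The hyperbolic Ernst equation at a point. -/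
def ErnstEqAt (E : ℝ → ℝ → ℂ) (x y : ℝ) : Prop :=
  (((E x y).re : ℂ)) * (pdxy E x y - (pdx E x y + pdy E x y) / (2 * (1 - x - y))) =
    pdx E x y * pdy E x y

/-- The Euler–Darboux equation at a point. -/
def EulerDarbouxAt (V : ℝ → ℝ → ℝ) (x y : ℝ) : Prop :=
  pdxyR V x y - (pdxR V x y + pdyR V x y) / (2 * (1 - x - y)) = 0

/-- `λ(x,y,k) = √((k-(1-y))/(k-x))`, principal branch (`Re λ > 0` off the cut). -/
def lam (x y : ℝ) (k : ℂ) : ℂ := ((k - (1 - (y : ℂ))) / (k - (x : ℂ))) ^ (1/2 : ℂ)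

/-- The segment `[0,1]` inside `ℂ`. -/
def seg01 : Set ℂ := (fun t : ℝ => (t : ℂ)) '' Icc 0 1

/-- A `C^n`-solution of the Goursat problem for the hyperbolic Ernst equation in `D`
with data `{E0, E1}`, with regularity exponent `α`. -/
def ErnstSolutionWith (n : ℕ) (α : ℝ) (E : ℝ → ℝ → ℂ) (E0 E1 : ℝ → ℂ) : Prop :=
  ContinuousOn (fun p : ℝ × ℝ => E p.1 p.2) TriD ∧
  ContDiffOn ℝ n (fun p : ℝ × ℝ => E p.1 p.2) (interior TriD) ∧
  (∀ p ∈ interior TriD, ErnstEqAt E p.1 p.2) ∧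
  (∃ g : ℝ × ℝ → ℂ, ContinuousOn g TriD ∧
      ∀ p ∈ interior TriD, g p = ((p.1 ^ α : ℝ) : ℂ) * pdx E p.1 p.2) ∧
  (∃ g : ℝ × ℝ → ℂ, ContinuousOn g TriD ∧
      ∀ p ∈ interior TriD, g p = ((p.2 ^ α : ℝ) : ℂ) * pdy E p.1 p.2) ∧
  (∃ g : ℝ × ℝ → ℂ, ContinuousOn g TriD ∧
      ∀ p ∈ interior TriD, g p = ((p.1 ^ α * p.2 ^ α : ℝ) : ℂ) * pdxy E p.1 p.2) ∧
  (∀ x ∈ Ico (0:ℝ) 1, E x 0 = E0 x) ∧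
  (∀ y ∈ Ico (0:ℝ) 1, E 0 y = E1 y) ∧
  (∀ p ∈ TriD, 0 < (E p.1 p.2).re)

/-- A `C^n`-solution of the Goursat problem for the hyperbolic Ernst equation in `D`
(with regularity exponent `α` existentially quantified over `[0,1)`). -/
def ErnstSolution (n : ℕ) (E : ℝ → ℝ → ℂ) (E0 E1 : ℝ → ℂ) : Prop :=
  ∃ α ∈ Ico (0:ℝ) 1, ErnstSolutionWith n α E E0 E1

/-- A `C^n`-solution of the Goursat problem for the Euler–Darboux equation in `D`
with data `{V0, V1}`, with regularity exponent `α`. -/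
def EDSolutionWith (n : ℕ) (α : ℝ) (V : ℝ → ℝ → ℝ) (V0 V1 : ℝ → ℝ) : Prop :=
  ContinuousOn (fun p : ℝ × ℝ => V p.1 p.2) TriD ∧
  ContDiffOn ℝ n (fun p : ℝ × ℝ => V p.1 p.2) (interior TriD) ∧
  (∀ p ∈ interior TriD, EulerDarbouxAt V p.1 p.2) ∧
  (∃ g : ℝ × ℝ → ℝ, ContinuousOn g TriD ∧
      ∀ p ∈ interior TriD, g p = p.1 ^ α * pdxR V p.1 p.2) ∧
  (∃ g : ℝ × ℝ → ℝ, ContinuousOn g TriD ∧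
      ∀ p ∈ interior TriD, g p = p.2 ^ α * pdyR V p.1 p.2) ∧
  (∃ g : ℝ × ℝ → ℝ, ContinuousOn g TriD ∧
      ∀ p ∈ interior TriD, g p = p.1 ^ α * p.2 ^ α * pdxyR V p.1 p.2) ∧
  (∀ x ∈ Ico (0:ℝ) 1, V x 0 = V0 x) ∧
  (∀ y ∈ Ico (0:ℝ) 1, V 0 y = V1 y)

/-- A `C^n`-solution of the Goursat problem for the Euler–Darboux equation in `D`. -/
def EDSolution (n : ℕ) (V : ℝ → ℝ → ℝ) (V0 V1 : ℝ → ℝ) : Prop :=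
  ∃ α ∈ Ico (0:ℝ) 1, EDSolutionWith n α V V0 V1

/-- The data assumptions (1.5) on a single boundary datum for the Ernst equation. -/
def ErnstData (n : ℕ) (α : ℝ) (E0 : ℝ → ℂ) : Prop :=
  ContinuousOn E0 (Ico 0 1) ∧ ContDiffOn ℝ n E0 (Ioo 0 1) ∧
  (∃ g : ℝ → ℂ, ContinuousOn g (Ico 0 1) ∧
      ∀ x ∈ Ioo (0:ℝ) 1, g x = ((x ^ α : ℝ) : ℂ) * deriv E0 x) ∧
  E0 0 = 1 ∧ (∀ x ∈ Ico (0:ℝ) 1, 0 < (E0 x).re)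

/-- The data assumptions on a single boundary datum for the Euler–Darboux equation. -/
def EDData (n : ℕ) (α : ℝ) (V0 : ℝ → ℝ) : Prop :=
  ContinuousOn V0 (Ico 0 1) ∧ ContDiffOn ℝ n V0 (Ioo 0 1) ∧
  (∃ g : ℝ → ℝ, ContinuousOn g (Ico 0 1) ∧
      ∀ x ∈ Ioo (0:ℝ) 1, g x = x ^ α * deriv V0 x) ∧
  V0 0 = 0

/-- The matrix `U0(x,k)` of the x-part of the Lax pair, built from the boundary datum. -/
def U0mat (E0 : ℝ → ℂ) (x : ℝ) (k : ℂ) : Matrix (Fin 2) (Fin 2) ℂ :=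
  (1 / (2 * ((E0 x).re : ℂ))) •
    !![conj (deriv E0 x), lam x 0 k * conj (deriv E0 x);
       lam x 0 k * deriv E0 x, deriv E0 x]

/-- The matrix `U(x,y,k)` of the Lax pair. -/
def Umat (E : ℝ → ℝ → ℂ) (k : ℂ) (x y : ℝ) : Matrix (Fin 2) (Fin 2) ℂ :=
  (1 / (2 * ((E x y).re : ℂ))) •
    !![conj (pdx E x y), lam x y k * conj (pdx E x y);
       lam x y k * pdx E x y, pdx E x y]

/-- The matrix `V(x,y,k)` of the Lax pair. -/
def Vmat (E : ℝ → ℝ → ℂ) (k : ℂ) (x y : ℝ) : Matrix (Fin 2) (Fin 2) ℂ :=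
  (1 / (2 * ((E x y).re : ℂ))) •
    !![conj (pdy E x y), (lam x y k)⁻¹ * conj (pdy E x y);
       (lam x y k)⁻¹ * pdy E x y, pdy E x y]

/-- A weighted mean value estimate: a function vanishing at `0` whose derivative is bounded by
`C t^{-α} exp (L t^{1-α} / (1-α))` is bounded by `(C / L) exp (L t^{1-α} / (1-α))`. -/
lemma norm_le_of_norm_deriv_le_rpow_mul_exp {α C L T : ℝ} (hα : α < 1) (hC : 0 ≤ C) (hL : 0 < L)
    (hT : 0 < T) {f f' : ℝ → ℂ} (hf0 : Tendsto f (𝓝[>] 0) (𝓝 0))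
    (hf : ∀ t ∈ Ioc 0 T, HasDerivAt f (f' t) t)
    (hbd : ∀ t ∈ Ioc 0 T, ‖f' t‖ ≤ C * t ^ (-α) * Real.exp (L * (t ^ (1 - α) / (1 - α)))) :
    ‖f T‖ ≤ C / L * Real.exp (L * (T ^ (1 - α) / (1 - α))) := by
  set B : ℝ → ℝ := fun t => C / L * Real.exp (L * (t ^ (1 - α) / (1 - α))) with hB
  have hα' : 1 - α ≠ 0 := by linarith
  have hBd : ∀ t, 0 < t →
      HasDerivAt B (C * t ^ (-α) * Real.exp (L * (t ^ (1 - α) / (1 - α)))) t := by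
    intro t ht
    have h1 := ((((Real.hasDerivAt_rpow_const (p := 1 - α) (Or.inl ht.ne')).div_const
      (1 - α)).const_mul L).exp).const_mul (C / L)
    refine h1.congr_deriv ?_
    rw [show 1 - α - 1 = -α by ring]
    field_simp
  have key : ∀ ε ∈ Ioo 0 T, ‖f T‖ ≤ ‖f ε‖ + B T := by
    intro ε hε
    have hsub : ∀ t ∈ Icc ε T, t ∈ Ioc 0 T := fun t ht => ⟨hε.1.trans_le ht.1, ht.2⟩
    have hle := image_norm_le_of_norm_deriv_right_le_deriv_boundary' (f := f) (f' := f')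
      (a := ε) (b := T) (B := fun t => ‖f ε‖ - B ε + B t)
      (B' := fun t => C * t ^ (-α) * Real.exp (L * (t ^ (1 - α) / (1 - α))))
      (fun t ht => (hf t (hsub t ht)).continuousAt.continuousWithinAt)
      (fun t ht => (hf t (hsub t (Ico_subset_Icc_self ht))).hasDerivWithinAt)
      (by simp)
      (fun t ht => ((hBd t (hsub t ht).1).const_add _).continuousAt.continuousWithinAt)
      (fun t ht => ((hBd t (hsub t (Ico_subset_Icc_self ht)).1).const_add _).hasDerivWithinAt)
      (fun t ht => hbd t (hsub t (Ico_subset_Icc_self ht)))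
      (right_mem_Icc.2 hε.2.le)
    have : 0 ≤ B ε := by positivity
    linarith
  have hlim : Tendsto (fun ε => ‖f ε‖ + B T) (𝓝[>] 0) (𝓝 (‖(0 : ℂ)‖ + B T)) :=
    hf0.norm.add_const _
  have := ge_of_tendsto hlim (by
    filter_upwards [Ioo_mem_nhdsGT hT] with ε hε using key ε hε)
  simpa using this

/-- If `w` vanishes on `y = 0` and `x ^ α * w_x` is continuous up to `y = 0`, then `w_x` tends to
zero as `y → 0`. -/
lemma tendsto_partial_zero {α X Y : ℝ} (hY : 0 < Y) {w wx g : ℝ → ℝ → ℂ}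
    (hw : ContinuousOn (fun p : ℝ × ℝ => w p.1 p.2) (Icc 0 X ×ˢ Icc 0 Y))
    (hw0 : ∀ x ∈ Icc 0 X, w x 0 = 0)
    (hg : ContinuousOn (fun p : ℝ × ℝ => g p.1 p.2) (Icc 0 X ×ˢ Icc 0 Y))
    (hgx : ∀ x ∈ Ioc 0 X, ∀ y ∈ Ioc 0 Y, g x y = ((x ^ α : ℝ) : ℂ) * wx x y)
    (hwx : ∀ x ∈ Ioc 0 X, ∀ y ∈ Ioc 0 Y, HasDerivAt (fun t => w t y) (wx x y) x)
    {x : ℝ} (hx : x ∈ Ioc 0 X) :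
    Tendsto (fun t => wx x t) (𝓝[>] 0) (𝓝 0) := by
  set h : ℝ × ℝ → ℂ := fun p => ((p.1 ^ (-α) : ℝ) : ℂ) * g p.1 p.2 with hh
  have hhc : ContinuousOn h (Ioc 0 X ×ˢ Icc 0 Y) := by
    refine ContinuousOn.mul ?_ (hg.mono (prod_mono Ioc_subset_Icc_self subset_rfl))
    intro p hp
    exact (continuous_ofReal.continuousAt.comp
      ((Real.continuousAt_rpow_const _ _ (Or.inl hp.1.1.ne')).comp
        continuousAt_fst)).continuousWithinAt
  have hwxh : ∀ s ∈ Ioc 0 X, ∀ t ∈ Ioc 0 Y, wx s t = h (s, t) := by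
    intro s hs t ht
    simp only [hh, hgx s hs t ht]
    rw [← mul_assoc, ← ofReal_mul, ← Real.rpow_add hs.1]
    simp
  have hvert : ∀ s ∈ Icc 0 X, ∀ F : ℝ × ℝ → ℂ, ∀ S : Set ℝ, s ∈ S →
      ContinuousOn F (S ×ˢ Icc 0 Y) → Tendsto (fun t => F (s, t)) (𝓝[>] 0) (𝓝 (F (s, 0))) := by
    intro s hs F S hsS hF
    have h1 : ContinuousOn (fun t => F (s, t)) (Icc 0 Y) :=
      hF.comp (by fun_prop) (fun t ht => ⟨hsS, ht⟩)
    have h2 := h1 0 (left_mem_Icc.2 hY.le)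
    exact h2.tendsto.mono_left (le_of_eq_of_le (nhdsWithin_Ioc_eq_nhdsGT hY).symm
      (nhdsWithin_mono _ Ioc_subset_Icc_self))
  have hc : h (x, 0) = 0 := by
    by_contra hne
    set c := h (x, 0) with hcdef
    obtain ⟨ε, hε, hεc⟩ : ∃ ε > 0, ε < ‖c‖ := ⟨‖c‖ / 2, by positivity, by
      have := norm_pos_iff.2 hne; linarith⟩
    obtain ⟨δ, hδ, hδh⟩ := Metric.continuousWithinAt_iff.1
      (hhc (x, 0) ⟨hx, left_mem_Icc.2 hY.le⟩) ε hε
    set x₁ := max (x - δ / 2) (x / 2) with hx₁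
    have hx1pos : 0 < x₁ := lt_max_of_lt_right (half_pos hx.1)
    have hx1lt : x₁ < x := max_lt (by linarith) (by linarith [hx.1])
    have hx1mem : x₁ ∈ Icc 0 X := ⟨hx1pos.le, hx1lt.le.trans hx.2⟩
    have hbound : ∀ t ∈ Ioo 0 (min δ Y),
        ‖w x t - w x₁ t - ((x - x₁ : ℝ) : ℂ) * c‖ ≤ ε * (x - x₁) := by
      intro t ht
      have htY : t ∈ Ioc 0 Y := ⟨ht.1, (ht.2.trans_le (min_le_right _ _)).le⟩
      have hmv := Convex.norm_image_sub_le_of_norm_hasDerivWithin_le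
        (f := fun s => w s t - (s : ℂ) * c) (f' := fun s => wx s t - 1 * c) (s := Icc x₁ x)
        (C := ε) (x := x₁) (y := x) (fun s hs => by
          have hs' : s ∈ Ioc 0 X := ⟨hx1pos.trans_le hs.1, hs.2.trans hx.2⟩
          exact ((hwx s hs' t htY).sub
            ((HasDerivAt.ofReal_comp (hasDerivAt_id s)).mul_const c)).hasDerivWithinAt)
        (fun s hs => by
          have hs' : s ∈ Ioc 0 X := ⟨hx1pos.trans_le hs.1, hs.2.trans hx.2⟩
          rw [hwxh s hs' t htY, one_mul, ← dist_eq_norm]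
          refine (hδh ⟨hs', Ioc_subset_Icc_self htY⟩ ?_).le
          rw [Prod.dist_eq, max_lt_iff, Real.dist_eq, Real.dist_eq, abs_lt, abs_lt]
          have := ht.2.trans_le (min_le_left _ _)
          have := (le_max_left (x - δ / 2) (x / 2)).trans hs.1
          have := hs.2
          have := ht.1
          refine ⟨⟨?_, ?_⟩, ?_, ?_⟩ <;> simp only <;> linarith)
        (convex_Icc _ _) (left_mem_Icc.2 hx1lt.le) (right_mem_Icc.2 hx1lt.le)
      rw [Real.norm_of_nonneg (by linarith)] at hmv
      refine le_of_eq_of_le (congrArg norm ?_) hmv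
      push_cast
      ring
    have hlim : Tendsto (fun t => ‖w x t - w x₁ t - ((x - x₁ : ℝ) : ℂ) * c‖) (𝓝[>] 0)
        (𝓝 ‖w x 0 - w x₁ 0 - ((x - x₁ : ℝ) : ℂ) * c‖) :=
      (((hvert x (Ioc_subset_Icc_self hx) _ _ (Ioc_subset_Icc_self hx) hw).sub
        (hvert x₁ hx1mem _ _ hx1mem hw)).sub_const _).norm
    have hle := le_of_tendsto hlim (by
      filter_upwards [Ioo_mem_nhdsGT (lt_min hδ hY)] with t ht using hbound t ht)
    rw [hw0 x (Ioc_subset_Icc_self hx), hw0 x₁ hx1mem, sub_zero, zero_sub, norm_neg, norm_mul,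
      norm_real, Real.norm_of_nonneg (by linarith), mul_comm] at hle
    exact absurd (le_of_mul_le_mul_right hle (by linarith)) (not_le.2 hεc)
  have := hvert x (Ioc_subset_Icc_self hx) h _ hx hhc
  rw [hc] at this
  refine this.congr' ?_
  filter_upwards [Ioc_mem_nhdsGT hY] with t ht using (hwxh x hx t ht).symm

/-- Uniqueness for a Goursat problem with zero data on a rectangle, for functions whose mixed
derivative is controlled linearly by `w`, `w_x`, `w_y` with weights singular at the axes. -/
lemma goursat_eq_zero {α X Y K : ℝ} (hα : α < 1) (hX : 0 < X) (hY : 0 < Y) (hK : 0 ≤ K)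
    {w wx wy wxy gx gy : ℝ → ℝ → ℂ}
    (hw : ContinuousOn (fun p : ℝ × ℝ => w p.1 p.2) (Icc 0 X ×ˢ Icc 0 Y))
    (hwx0 : ∀ x ∈ Icc 0 X, w x 0 = 0) (hw0y : ∀ y ∈ Icc 0 Y, w 0 y = 0)
    (hgxc : ContinuousOn (fun p : ℝ × ℝ => gx p.1 p.2) (Icc 0 X ×ˢ Icc 0 Y))
    (hgyc : ContinuousOn (fun p : ℝ × ℝ => gy p.1 p.2) (Icc 0 X ×ˢ Icc 0 Y))
    (hgx : ∀ x ∈ Ioc 0 X, ∀ y ∈ Ioc 0 Y, gx x y = ((x ^ α : ℝ) : ℂ) * wx x y)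
    (hgy : ∀ x ∈ Ioc 0 X, ∀ y ∈ Ioc 0 Y, gy x y = ((y ^ α : ℝ) : ℂ) * wy x y)
    (hwx : ∀ x ∈ Ioc 0 X, ∀ y ∈ Ioc 0 Y, HasDerivAt (fun t => w t y) (wx x y) x)
    (hwy : ∀ x ∈ Ioc 0 X, ∀ y ∈ Ioc 0 Y, HasDerivAt (fun t => w x t) (wy x y) y)
    (hwxy : ∀ x ∈ Ioc 0 X, ∀ y ∈ Ioc 0 Y, HasDerivAt (fun t => wx x t) (wxy x y) y)
    (hwyx : ∀ x ∈ Ioc 0 X, ∀ y ∈ Ioc 0 Y, HasDerivAt (fun t => wy t y) (wxy x y) x)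
    (hbd : ∀ x ∈ Ioc 0 X, ∀ y ∈ Ioc 0 Y, ‖wxy x y‖ ≤
      K * x ^ (-α) * y ^ (-α) * (‖w x y‖ + x ^ α * ‖wx x y‖ + y ^ α * ‖wy x y‖)) :
    w X Y = 0 := by
  set s : ℝ → ℝ := fun t => t ^ (1 - α) / (1 - α) with hs
  set L : ℝ := 2 * (2 * K + 1) with hLdef
  have hL : 0 < L := by positivity
  set M : ℝ → ℝ → ℝ := fun x y => ‖w x y‖ + x ^ α * ‖wx x y‖ + y ^ α * ‖wy x y‖ with hM
  have hspos : ∀ t, 0 < t → 0 ≤ s t := fun t ht =>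
    div_nonneg (Real.rpow_nonneg ht.le _) (by linarith)
  have hcancel : ∀ t : ℝ, 0 < t → t ^ α * t ^ (-α) = 1 := fun t ht => by
    rw [← Real.rpow_add ht]; simp
  have hwx_lim : ∀ x ∈ Ioc 0 X, Tendsto (fun t => wx x t) (𝓝[>] 0) (𝓝 0) := fun x hx =>
    tendsto_partial_zero hY hw hwx0 hgxc hgx hwx hx
  have hswap : MapsTo Prod.swap (Icc 0 Y ×ˢ Icc 0 X) (Icc 0 X ×ˢ Icc 0 Y) :=
    fun p hp => ⟨hp.2, hp.1⟩
  have hwy_lim : ∀ y ∈ Ioc 0 Y, Tendsto (fun t => wy t y) (𝓝[>] 0) (𝓝 0) := fun y hy =>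
    tendsto_partial_zero (w := fun a b => w b a) (wx := fun a b => wy b a)
      (g := fun a b => gy b a) hX (hw.comp continuous_swap.continuousOn hswap) hw0y
      (hgyc.comp continuous_swap.continuousOn hswap) (fun a ha b hb => hgy b hb a ha)
      (fun a ha b hb => hwy b hb a ha) hy
  have hw_lim : ∀ y ∈ Ioc 0 Y, Tendsto (fun t => w t y) (𝓝[>] 0) (𝓝 0) := by
    intro y hy
    have h1 : ContinuousOn (fun t => w t y) (Icc 0 X) :=
      hw.comp (f := fun t => (t, y)) (by fun_prop) (fun t ht => ⟨ht, Ioc_subset_Icc_self hy⟩)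
    have h2 := (h1 0 (left_mem_Icc.2 hX.le)).tendsto
    rw [hw0y y (Ioc_subset_Icc_self hy)] at h2
    exact h2.mono_left (le_of_eq_of_le (nhdsWithin_Ioc_eq_nhdsGT hX).symm
      (nhdsWithin_mono _ Ioc_subset_Icc_self))
  have hstep : ∀ N : ℝ, 0 ≤ N →
      (∀ x ∈ Ioc 0 X, ∀ y ∈ Ioc 0 Y, M x y ≤ N * (Real.exp (L * s x) * Real.exp (L * s y))) →
      ∀ x ∈ Ioc 0 X, ∀ y ∈ Ioc 0 Y,
        M x y ≤ N / 2 * (Real.exp (L * s x) * Real.exp (L * s y)) := by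
    intro N hN hMN x hx y hy
    have hxα := Real.rpow_pos_of_pos hx.1 α
    have hyα := Real.rpow_pos_of_pos hy.1 α
    have hxα' := Real.rpow_pos_of_pos hx.1 (-α)
    have hyα' := Real.rpow_pos_of_pos hy.1 (-α)
    have hwxb : ‖wx x y‖ ≤ K * N * x ^ (-α) * Real.exp (L * s x) / L * Real.exp (L * s y) := by
      refine norm_le_of_norm_deriv_le_rpow_mul_exp hα (by positivity) hL hy.1 (hwx_lim x hx)
        (fun t ht => hwxy x hx t ⟨ht.1, ht.2.trans hy.2⟩) (fun t ht => ?_)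
      have ht' : t ∈ Ioc 0 Y := ⟨ht.1, ht.2.trans hy.2⟩
      have := Real.rpow_pos_of_pos ht.1 (-α)
      calc _ ≤ K * x ^ (-α) * t ^ (-α) * M x t := hbd x hx t ht'
        _ ≤ K * x ^ (-α) * t ^ (-α) * (N * (Real.exp (L * s x) * Real.exp (L * s t))) := by
          gcongr; exact hMN x hx t ht'
        _ = _ := by ring
    have hwyb : ‖wy x y‖ ≤ K * N * y ^ (-α) * Real.exp (L * s y) / L * Real.exp (L * s x) := by
      refine norm_le_of_norm_deriv_le_rpow_mul_exp (f := fun t => wy t y) hα (by positivity) hL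
        hx.1 (hwy_lim y hy)
        (fun t ht => hwyx t ⟨ht.1, ht.2.trans hx.2⟩ y hy) (fun t ht => ?_)
      have ht' : t ∈ Ioc 0 X := ⟨ht.1, ht.2.trans hx.2⟩
      have := Real.rpow_pos_of_pos ht.1 (-α)
      calc _ ≤ K * t ^ (-α) * y ^ (-α) * M t y := hbd t ht' y hy
        _ ≤ K * t ^ (-α) * y ^ (-α) * (N * (Real.exp (L * s t) * Real.exp (L * s y))) := by
          gcongr; exact hMN t ht' y hy
        _ = _ := by ring
    have hwb : ‖w x y‖ ≤ N * Real.exp (L * s y) / L * Real.exp (L * s x) := by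
      refine norm_le_of_norm_deriv_le_rpow_mul_exp (f := fun t => w t y) hα (by positivity) hL
        hx.1 (hw_lim y hy)
        (fun t ht => hwx t ⟨ht.1, ht.2.trans hx.2⟩ y hy) (fun t ht => ?_)
      have ht' : t ∈ Ioc 0 X := ⟨ht.1, ht.2.trans hx.2⟩
      have htα := Real.rpow_pos_of_pos ht.1 (-α)
      have hle : t ^ α * ‖wx t y‖ ≤ M t y := by
        have h1 := norm_nonneg (w t y)
        have h2 : 0 ≤ y ^ α * ‖wy t y‖ := by positivity
        simp only [hM]; linarith
      calc ‖wx t y‖ = t ^ (-α) * (t ^ α * ‖wx t y‖) := by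
            rw [← mul_assoc, mul_comm (t ^ (-α)), hcancel t ht.1, one_mul]
        _ ≤ t ^ (-α) * (N * (Real.exp (L * s t) * Real.exp (L * s y))) := by
          exact mul_le_mul_of_nonneg_left (hle.trans (hMN t ht' y hy)) htα.le
        _ = _ := by ring
    have hu := mul_le_mul_of_nonneg_left hwxb hxα.le
    have hv := mul_le_mul_of_nonneg_left hwyb hyα.le
    calc M x y ≤ _ := add_le_add (add_le_add hwb hu) hv
      _ = (1 + K * (x ^ α * x ^ (-α)) + K * (y ^ α * y ^ (-α))) *
          N / L * (Real.exp (L * s x) * Real.exp (L * s y)) := by ring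
      _ = _ := by
        rw [hcancel x hx.1, hcancel y hy.1, hLdef]
        field_simp
        ring
  have hcpt : IsCompact (Icc 0 X ×ˢ Icc 0 Y) := isCompact_Icc.prod isCompact_Icc
  obtain ⟨N₁, hN₁⟩ := hcpt.exists_bound_of_continuousOn hw
  obtain ⟨N₂, hN₂⟩ := hcpt.exists_bound_of_continuousOn hgxc
  obtain ⟨N₃, hN₃⟩ := hcpt.exists_bound_of_continuousOn hgyc
  set N := |N₁ + N₂ + N₃| with hN
  have hall : ∀ k : ℕ, ∀ x ∈ Ioc 0 X, ∀ y ∈ Ioc 0 Y,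
      M x y ≤ N * (1 / 2) ^ k * (Real.exp (L * s x) * Real.exp (L * s y)) := by
    intro k
    induction k with
    | zero =>
      intro x hx y hy
      have hp : (x, y) ∈ Icc 0 X ×ˢ Icc 0 Y := ⟨Ioc_subset_Icc_self hx, Ioc_subset_Icc_self hy⟩
      have h1 := hN₁ _ hp
      have h2 := hN₂ _ hp
      have h3 := hN₃ _ hp
      simp only [hgx x hx y hy, hgy x hx y hy, norm_mul, norm_real,
        Real.norm_of_nonneg (Real.rpow_nonneg hx.1.le α),
        Real.norm_of_nonneg (Real.rpow_nonneg hy.1.le α)] at h1 h2 h3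
      have hMle : M x y ≤ N := by
        have := le_abs_self (N₁ + N₂ + N₃)
        simp only [hM]; linarith
      have e1 : 1 ≤ Real.exp (L * s x) := Real.one_le_exp (mul_nonneg hL.le (hspos x hx.1))
      have e2 : 1 ≤ Real.exp (L * s y) := Real.one_le_exp (mul_nonneg hL.le (hspos y hy.1))
      rw [pow_zero, mul_one]
      exact hMle.trans (le_mul_of_one_le_right (abs_nonneg _) (one_le_mul_of_one_le_of_one_le e1 e2))
    | succ k ih =>
      have := hstep _ (by positivity) ih
      convert this using 7
      ring
  have hlim : Tendsto (fun k : ℕ => N * (1 / 2 : ℝ) ^ k * (Real.exp (L * s X) * Real.exp (L * s Y)))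
      atTop (𝓝 (N * 0 * (Real.exp (L * s X) * Real.exp (L * s Y)))) :=
    ((tendsto_pow_atTop_nhds_zero_of_lt_one (by norm_num) (by norm_num)).const_mul N).mul_const _
  have hM0 := ge_of_tendsto' hlim
    (fun k => hall k X (right_mem_Ioc.2 hX) Y (right_mem_Ioc.2 hY))
  rw [mul_zero, zero_mul] at hM0
  have h1 : 0 ≤ X ^ α * ‖wx X Y‖ := by positivity
  have h2 : 0 ≤ Y ^ α * ‖wy X Y‖ := by positivity
  exact norm_le_zero_iff.1 (by simp only [hM] at hM0; linarith)

lemma mem_interior_triD {x y : ℝ} (hx : 0 < x) (hy : 0 < y) (hxy : x + y < 1) :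
    (x, y) ∈ interior TriD := by
  have hopen : IsOpen {p : ℝ × ℝ | 0 < p.1 ∧ 0 < p.2 ∧ p.1 + p.2 < 1} :=
    (isOpen_lt continuous_const continuous_fst).inter
      ((isOpen_lt continuous_const continuous_snd).inter
        (isOpen_lt (continuous_fst.add continuous_snd) continuous_const))
  have hsub : {p : ℝ × ℝ | 0 < p.1 ∧ 0 < p.2 ∧ p.1 + p.2 < 1} ⊆ TriD :=
    fun p hp => ⟨hp.1.le, hp.2.1.le, hp.2.2⟩
  exact interior_maximal hsub hopen ⟨hx, hy, hxy⟩

/-- For a function that is `C²` near `(x, y)`, the partial derivatives exist and the mixed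
derivative may be computed in either order. -/
lemma hasDerivAt_partials {E : ℝ → ℝ → ℂ} {x y : ℝ}
    (hE : ContDiffAt ℝ 2 (fun p : ℝ × ℝ => E p.1 p.2) (x, y)) :
    HasDerivAt (fun t => E t y) (pdx E x y) x ∧
    HasDerivAt (fun t => E x t) (pdy E x y) y ∧
    HasDerivAt (fun t => pdx E x t) (pdxy E x y) y ∧
    HasDerivAt (fun t => pdy E t y) (pdxy E x y) x := by
  set f : ℝ × ℝ → ℂ := fun p => E p.1 p.2 with hf
  have hline₁ : ∀ a b : ℝ, HasDerivAt (fun t : ℝ => (t, b)) ((1 : ℝ), (0 : ℝ)) a := fun a b =>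
    (hasDerivAt_id a).prodMk (hasDerivAt_const a b)
  have hline₂ : ∀ a b : ℝ, HasDerivAt (fun t : ℝ => (a, t)) ((0 : ℝ), (1 : ℝ)) b := fun a b =>
    (hasDerivAt_const b a).prodMk (hasDerivAt_id b)
  have hdx : ∀ a b, DifferentiableAt ℝ f (a, b) →
      HasDerivAt (fun t => E t b) (fderiv ℝ f (a, b) (1, 0)) a := fun a b h =>
    HasFDerivAt.comp_hasDerivAt (l := f) a h.hasFDerivAt (hline₁ a b)
  have hdy : ∀ a b, DifferentiableAt ℝ f (a, b) →
      HasDerivAt (fun t => E a t) (fderiv ℝ f (a, b) (0, 1)) b := fun a b h =>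
    HasFDerivAt.comp_hasDerivAt (l := f) b h.hasFDerivAt (hline₂ a b)
  have hdiff : ∀ᶠ p in 𝓝 (x, y), DifferentiableAt ℝ f p := by
    filter_upwards [hE.eventually (by simp)] with p hp using hp.differentiableAt (by simp)
  have hd2 : DifferentiableAt ℝ (fderiv ℝ f) (x, y) :=
    (hE.fderiv_right (m := 1) (by norm_num)).differentiableAt (by simp)
  have hsymm := (hE.isSymmSndFDerivAt (by simp)).eq (1, 0) (0, 1)
  have hdiff₁ : ∀ᶠ t in 𝓝 x, DifferentiableAt ℝ f (t, y) :=
    (hline₁ x y).continuousAt.eventually hdiff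
  have hdiff₂ : ∀ᶠ t in 𝓝 y, DifferentiableAt ℝ f (x, t) :=
    (hline₂ x y).continuousAt.eventually hdiff
  have hyx : HasDerivAt (fun t => pdy E t y) (fderiv ℝ (fderiv ℝ f) (x, y) (1, 0) (0, 1)) x := by
    have h := (ContinuousLinearMap.apply ℝ ℂ ((0 : ℝ), (1 : ℝ))).hasFDerivAt.comp_hasDerivAt x
      (HasFDerivAt.comp_hasDerivAt (l := fderiv ℝ f) x hd2.hasFDerivAt (hline₁ x y))
    refine h.congr_of_eventuallyEq ?_
    filter_upwards [hdiff₁] with t ht using (hdy t y ht).deriv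
  have hxy : HasDerivAt (fun t => pdx E x t) (fderiv ℝ (fderiv ℝ f) (x, y) (0, 1) (1, 0)) y := by
    have h := (ContinuousLinearMap.apply ℝ ℂ ((1 : ℝ), (0 : ℝ))).hasFDerivAt.comp_hasDerivAt y
      (HasFDerivAt.comp_hasDerivAt (l := fderiv ℝ f) y hd2.hasFDerivAt (hline₂ x y))
    refine h.congr_of_eventuallyEq ?_
    filter_upwards [hdiff₂] with t ht using (hdx x t ht).deriv
  have hval : pdxy E x y = fderiv ℝ (fderiv ℝ f) (x, y) (1, 0) (0, 1) := hyx.deriv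
  refine ⟨(hdx x y hdiff.self_of_nhds).differentiableAt.hasDerivAt,
    (hdy x y hdiff.self_of_nhds).differentiableAt.hasDerivAt, ?_, ?_⟩
  · rw [hval, hsymm]; exact hxy
  · rw [hval]; exact hyx

/-- Increasing the weight exponent preserves continuous extendability. -/
lemma exists_continuousOn_rpow_mul_of_le {S U : Set (ℝ × ℝ)} {α β : ℝ} (hαβ : α ≤ β)
    {c : ℝ × ℝ → ℝ} (hc : Continuous c) {F : ℝ × ℝ → ℂ}
    (hU : ∀ p ∈ U, 0 < c p)
    (h : ∃ g : ℝ × ℝ → ℂ, ContinuousOn g S ∧ ∀ p ∈ U, g p = ((c p ^ α : ℝ) : ℂ) * F p) :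
    ∃ g : ℝ × ℝ → ℂ, ContinuousOn g S ∧ ∀ p ∈ U, g p = ((c p ^ β : ℝ) : ℂ) * F p := by
  obtain ⟨g, hg, hgF⟩ := h
  refine ⟨fun p => ((c p ^ (β - α) : ℝ) : ℂ) * g p, ContinuousOn.mul ?_ hg, fun p hp => ?_⟩
  · exact (continuous_ofReal.comp
      ((Real.continuous_rpow_const (sub_nonneg.2 hαβ)).comp hc)).continuousOn
  · simp only [hgF p hp]
    rw [← mul_assoc, ← ofReal_mul, ← Real.rpow_add (hU p hp), sub_add_cancel]

/-- Lipschitz estimate for the right-hand side `κ (a + b) + a b / r` of the Ernst equation. -/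
lemma norm_ernst_rhs_sub_le {C P Q u v d : ℝ} {κ a b a' b' r r' : ℂ} (hC : 0 ≤ C)
    (hP : 1 ≤ P) (hQ : 1 ≤ Q) (hu : 0 ≤ u) (hv : 0 ≤ v)
    (hκ : ‖κ‖ ≤ C) (hr : ‖r⁻¹‖ ≤ C) (hr' : ‖r'⁻¹‖ ≤ C) (hr0 : r ≠ 0) (hr0' : r' ≠ 0)
    (hb : ‖b‖ ≤ Q * C) (ha' : ‖a'‖ ≤ P * C) (hb' : ‖b'‖ ≤ Q * C)
    (hau : ‖a - a'‖ = P * u) (hbv : ‖b - b'‖ = Q * v) (hrd : ‖r' - r‖ ≤ d) :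
    ‖κ * (a + b) + a * b * r⁻¹ - (κ * (a' + b') + a' * b' * r'⁻¹)‖ ≤
      (C + C ^ 2 + C ^ 4) * P * Q * (d + u + v) := by
  have hd : 0 ≤ d := (norm_nonneg _).trans hrd
  have hP0 : 0 ≤ P := by linarith
  have hQ0 : 0 ≤ Q := by linarith
  have hsplit : κ * (a + b) + a * b * r⁻¹ - (κ * (a' + b') + a' * b' * r'⁻¹) =
      κ * (a - a') + κ * (b - b') + (a - a') * b * r⁻¹ + a' * (b - b') * r⁻¹ +
        a' * b' * ((r' - r) * r⁻¹ * r'⁻¹) := by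
    field_simp
    ring
  have t1 : ‖κ * (a - a')‖ ≤ C * (P * Q * u) := by
    rw [norm_mul, hau]
    exact mul_le_mul hκ (by nlinarith [mul_nonneg hP0 hu]) (by positivity) hC
  have t2 : ‖κ * (b - b')‖ ≤ C * (P * Q * v) := by
    rw [norm_mul, hbv]
    exact mul_le_mul hκ (by nlinarith [mul_nonneg hQ0 hv]) (by positivity) hC
  have t3 : ‖(a - a') * b * r⁻¹‖ ≤ P * u * (Q * C) * C := by
    rw [norm_mul, norm_mul, hau]; gcongr
  have t4 : ‖a' * (b - b') * r⁻¹‖ ≤ P * C * (Q * v) * C := by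
    rw [norm_mul, norm_mul, hbv]; gcongr
  have t5 : ‖a' * b' * ((r' - r) * r⁻¹ * r'⁻¹)‖ ≤ P * C * (Q * C) * (d * C * C) := by
    simp only [norm_mul]; gcongr
  rw [hsplit]
  refine (norm_add_le_of_le (norm_add_le_of_le (norm_add_le_of_le (norm_add_le_of_le t1 t2) t3)
    t4) t5).trans ?_
  have h1 : 0 ≤ (C + C ^ 2) * P * Q * d := by positivity
  have h2 : 0 ≤ C ^ 4 * P * Q * (u + v) := by positivity
  nlinarith

lemma ErnstEqAt.pdxy_eq {E : ℝ → ℝ → ℂ} {x y : ℝ} (h : ErnstEqAt E x y) (hr : 0 < (E x y).re) :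
    pdxy E x y = (2 * (1 - (x : ℂ) - y))⁻¹ * (pdx E x y + pdy E x y) +
      pdx E x y * pdy E x y * ((E x y).re : ℂ)⁻¹ := by
  have hr' : ((E x y).re : ℂ) ≠ 0 := ofReal_ne_zero.2 hr.ne'
  unfold ErnstEqAt at h
  rw [← h, mul_comm _ ((E x y).re : ℂ)⁻¹, inv_mul_cancel_left₀ hr']
  ring

lemma norm_le_rpow_neg_mul {x α C : ℝ} (hx : 0 < x) {z g : ℂ}
    (hg : g = ((x ^ α : ℝ) : ℂ) * z) (hC : ‖g‖ ≤ C) : ‖z‖ ≤ x ^ (-α) * C := by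
  have hz : ‖z‖ = x ^ (-α) * ‖g‖ := by
    rw [hg, norm_mul, norm_real, Real.norm_of_nonneg (Real.rpow_nonneg hx.le α), ← mul_assoc,
      ← Real.rpow_add hx]
    simp
  rw [hz]
  exact mul_le_mul_of_nonneg_left hC (Real.rpow_nonneg hx.le _)

/-- Uniqueness of the C^n-solution of the Goursat problem for the hyperbolic
Ernst equation: the value of the solution at (x,y) ∈ D depends only on the boundary data
on [0,x] and [0,y]. In particular the solution with given data is unique if it exists. -/
theorem ernst_goursat_uniqueness
    (n : ℕ) (hn : 2 ≤ n) (α : ℝ) (hα : α ∈ Ico (0:ℝ) 1)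
    (E0 E1 E0' E1' : ℝ → ℂ)
    (hd0 : ErnstData n α E0) (hd1 : ErnstData n α E1)
    (hd0' : ErnstData n α E0') (hd1' : ErnstData n α E1')
    (E E' : ℝ → ℝ → ℂ)
    (hE : ErnstSolution n E E0 E1) (hE' : ErnstSolution n E' E0' E1')
    (x y : ℝ) (hxy : (x, y) ∈ TriD)
    (h0 : ∀ x' ∈ Icc 0 x, E0 x' = E0' x')
    (h1 : ∀ y' ∈ Icc 0 y, E1 y' = E1' y') :
    E x y = E' x y := by
  obtain ⟨hx0, hy0, hlt⟩ := hxy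
  simp only at hx0 hy0 hlt
  obtain ⟨α₁, hα₁, hEc, hEd, hEe, hEx, hEy, -, hE0, hE1, hEr⟩ := hE
  obtain ⟨α₂, hα₂, hEc', hEd', hEe', hEx', hEy', -, hE0', hE1', hEr'⟩ := hE'
  have hbot : ∀ s ∈ Icc 0 x, E s 0 = E' s 0 := fun s hs => by
    have hs' : s ∈ Ico (0 : ℝ) 1 := ⟨hs.1, by linarith [hs.2]⟩
    rw [hE0 s hs', hE0' s hs', h0 s hs]
  have hleft : ∀ t ∈ Icc 0 y, E 0 t = E' 0 t := fun t ht => by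
    have ht' : t ∈ Ico (0 : ℝ) 1 := ⟨ht.1, by linarith [ht.2]⟩
    rw [hE1 t ht', hE1' t ht', h1 t ht]
  rcases hx0.eq_or_lt with rfl | hx
  · exact hleft y (right_mem_Icc.2 hy0)
  rcases hy0.eq_or_lt with rfl | hy
  · exact hbot x (right_mem_Icc.2 hx0)
  have hpos : ∀ p ∈ interior TriD, 0 < p.1 ∧ 0 < p.2 := by
    intro p hp
    have hsub : TriD ⊆ Ici 0 ×ˢ Ici 0 := fun q hq => ⟨hq.1, hq.2.1⟩
    have := interior_mono hsub hp
    rwa [interior_prod_eq, interior_Ici, mem_prod] at this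
  set β := max α₁ α₂ with hβ
  have hβ1 : β < 1 := max_lt hα₁.2 hα₂.2
  have hβ0 : 0 ≤ β := hα₁.1.trans (le_max_left _ _)
  obtain ⟨gx, hgxc, hgx⟩ := exists_continuousOn_rpow_mul_of_le (le_max_left α₁ α₂) continuous_fst
    (F := fun p => pdx E p.1 p.2) (fun p hp => (hpos p hp).1) hEx
  obtain ⟨gy, hgyc, hgy⟩ := exists_continuousOn_rpow_mul_of_le (le_max_left α₁ α₂) continuous_snd
    (F := fun p => pdy E p.1 p.2) (fun p hp => (hpos p hp).2) hEy
  obtain ⟨gx', hgxc', hgx'⟩ := exists_continuousOn_rpow_mul_of_le (le_max_right α₁ α₂)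
    continuous_fst (F := fun p => pdx E' p.1 p.2) (fun p hp => (hpos p hp).1) hEx'
  obtain ⟨gy', hgyc', hgy'⟩ := exists_continuousOn_rpow_mul_of_le (le_max_right α₁ α₂)
    continuous_snd (F := fun p => pdy E' p.1 p.2) (fun p hp => (hpos p hp).2) hEy'
  have hRD : Icc 0 x ×ˢ Icc 0 y ⊆ TriD := fun p hp =>
    ⟨hp.1.1, hp.2.1, by linarith [hp.1.2, hp.2.2]⟩
  have hint : ∀ s ∈ Ioc 0 x, ∀ t ∈ Ioc 0 y, (s, t) ∈ interior TriD := fun s hs t ht =>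
    mem_interior_triD hs.1 ht.1 (by linarith [hs.2, ht.2])
  have hsub : ∀ s ∈ Ioc 0 x, ∀ t ∈ Ioc 0 y, (s, t) ∈ Icc 0 x ×ˢ Icc 0 y := fun s hs t ht =>
    ⟨Ioc_subset_Icc_self hs, Ioc_subset_Icc_self ht⟩
  have hn' : (2 : WithTop ℕ∞) ≤ n := by exact_mod_cast hn
  have hD := fun s hs t ht => hasDerivAt_partials (E := E) (x := s) (y := t)
    ((hEd.contDiffAt (isOpen_interior.mem_nhds (hint s hs t ht))).of_le hn')
  have hD' := fun s hs t ht => hasDerivAt_partials (E := E') (x := s) (y := t)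
    ((hEd'.contDiffAt (isOpen_interior.mem_nhds (hint s hs t ht))).of_le hn')
  have hre : ∀ p ∈ TriD, ((E p.1 p.2).re : ℂ) ≠ 0 := fun p hp => ofReal_ne_zero.2 (hEr p hp).ne'
  have hre' : ∀ p ∈ TriD, ((E' p.1 p.2).re : ℂ) ≠ 0 := fun p hp =>
    ofReal_ne_zero.2 (hEr' p hp).ne'
  have hκ : ∀ p ∈ TriD, (2 * (1 - (p.1 : ℂ) - p.2)) ≠ 0 := by
    intro p hp
    have : (1 - p.1 - p.2 : ℝ) ≠ 0 := by linarith [hp.2.2]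
    exact mul_ne_zero two_ne_zero (by exact_mod_cast this)
  have hcre : ∀ F : ℝ × ℝ → ℂ, ContinuousOn F TriD →
      ContinuousOn (fun p => ((F p).re : ℂ)) TriD := fun F hF =>
    (continuous_ofReal.comp continuous_re).comp_continuousOn hF
  have hcont : ContinuousOn (fun p : ℝ × ℝ => ‖(2 * (1 - (p.1 : ℂ) - p.2))⁻¹‖ +
      ‖((E p.1 p.2).re : ℂ)⁻¹‖ + ‖((E' p.1 p.2).re : ℂ)⁻¹‖ + ‖gy p‖ + ‖gx' p‖ + ‖gy' p‖) TriD :=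
    ((((((ContinuousOn.inv₀ (by fun_prop) hκ).norm).add ((hcre _ hEc).inv₀ hre).norm).add
      ((hcre _ hEc').inv₀ hre').norm).add hgyc.norm).add hgxc'.norm).add hgyc'.norm
  obtain ⟨C, hC⟩ := (isCompact_Icc.prod isCompact_Icc).exists_bound_of_continuousOn
    (hcont.mono hRD)
  have hC0 : 0 ≤ C := (norm_nonneg _).trans
    (hC (0, 0) ⟨left_mem_Icc.2 hx0, left_mem_Icc.2 hy0⟩)
  refine sub_eq_zero.1 (goursat_eq_zero (w := fun s t => E s t - E' s t)
    (wx := fun s t => pdx E s t - pdx E' s t) (wy := fun s t => pdy E s t - pdy E' s t)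
    (wxy := fun s t => pdxy E s t - pdxy E' s t) (gx := fun s t => gx (s, t) - gx' (s, t))
    (gy := fun s t => gy (s, t) - gy' (s, t)) (K := C + C ^ 2 + C ^ 4) hβ1 hx hy (by positivity)
    ((hEc.sub hEc').mono hRD) (fun s hs => sub_eq_zero.2 (hbot s hs))
    (fun t ht => sub_eq_zero.2 (hleft t ht)) ((hgxc.sub hgxc').mono hRD)
    ((hgyc.sub hgyc').mono hRD) ?_ ?_ (fun s hs t ht => (hD s hs t ht).1.sub (hD' s hs t ht).1)
    (fun s hs t ht => (hD s hs t ht).2.1.sub (hD' s hs t ht).2.1)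
    (fun s hs t ht => (hD s hs t ht).2.2.1.sub (hD' s hs t ht).2.2.1)
    (fun s hs t ht => (hD s hs t ht).2.2.2.sub (hD' s hs t ht).2.2.2) ?_)
  · intro s hs t ht
    rw [hgx _ (hint s hs t ht), hgx' _ (hint s hs t ht), mul_sub]
  · intro s hs t ht
    rw [hgy _ (hint s hs t ht), hgy' _ (hint s hs t ht), mul_sub]
  · intro s hs t ht
    have hp := hint s hs t ht
    have hpD := interior_subset hp
    rw [(hEe _ hp).pdxy_eq (hEr _ hpD), (hEe' _ hp).pdxy_eq (hEr' _ hpD)]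
    have hb := (le_abs_self _).trans (hC (s, t) (hsub s hs t ht))
    have n1 := norm_nonneg ((2 * (1 - (s : ℂ) - t))⁻¹)
    have n2 := norm_nonneg (((E s t).re : ℂ)⁻¹)
    have n3 := norm_nonneg (((E' s t).re : ℂ)⁻¹)
    have n4 := norm_nonneg (gy (s, t))
    have n5 := norm_nonneg (gx' (s, t))
    have n6 := norm_nonneg (gy' (s, t))
    simp only at hb
    have hpow : ∀ r : ℝ, 0 < r → r < 1 → 1 ≤ r ^ (-β) := fun r hr hr1 =>
      Real.one_le_rpow_of_pos_of_le_one_of_nonpos hr hr1.le (by linarith)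
    have hcancel : ∀ r : ℝ, 0 < r → ∀ m : ℝ, m = r ^ (-β) * (r ^ β * m) := fun r hr m => by
      rw [← mul_assoc, ← Real.rpow_add hr]; simp
    have hsβ := Real.rpow_pos_of_pos hs.1 β
    have htβ := Real.rpow_pos_of_pos ht.1 β
    refine norm_ernst_rhs_sub_le hC0 (hpow s hs.1 (by linarith [hs.2]))
      (hpow t ht.1 (by linarith [ht.2])) (by positivity) (by positivity) (by linarith)
      (by linarith) (by linarith) (hre _ hpD) (hre' _ hpD)
      (norm_le_rpow_neg_mul ht.1 (hgy _ hp) (by linarith))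
      (norm_le_rpow_neg_mul hs.1 (hgx' _ hp) (by linarith))
      (norm_le_rpow_neg_mul ht.1 (hgy' _ hp) (by linarith))
      (hcancel s hs.1 _) (hcancel t ht.1 _) ?_
    rw [← ofReal_sub, ← sub_re, norm_real, norm_sub_rev (E s t)]
    exact abs_re_le_norm _
end
end

section
/- Let n ≥ 2 be an integer and α ∈ [0,1). Let ℰ0, ℰ1 : [0,1) → ℝ be real-valued and strictly positive functions satisfying the data assumptions (so in particular ℰ0(0) = ℰ1(0) = 1). Then there exists a C^n-solution ℰ of the Goursat problem for the hyperbolic Ernst equation in D with data {ℰ0, ℰ1}; it is given by ℰ = e^{−V}, where V is the C^n-solution of the Goursat problem for the Euler–Darboux equation in D with data {−log ℰ0, −log ℰ1}. -/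
open Complex Set MeasureTheory Topology Filter ComplexConjugate

noncomputable section

section ParametricPrimitive

variable {E F : Type} [NormedAddCommGroup E] [NormedAddCommGroup F]
  {U : Set E} {b : ℝ} {f : ℝ → ℝ} {Ψ : E × ℝ → F}

lemma intervalIntegrable_smul_slice [NormedSpace ℝ F]
    (hf : ∀ c < b, IntervalIntegrable f volume (-1) c)
    (hΨ : ContinuousOn Ψ (U ×ˢ Iio b)) {p : E} (hp : p ∈ U) {a c : ℝ}
    (ha : a < b) (hc : c < b) :
    IntervalIntegrable (fun s => f s • Ψ (p, s)) volume a c := by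
  refine IntervalIntegrable.smul_continuousOn ((hf a ha).symm.trans (hf c hc)) ?_
  refine hΨ.comp (by fun_prop) fun s hs => ⟨hp, ?_⟩
  exact lt_of_le_of_lt hs.2 (max_lt ha hc)

variable [NormedSpace ℝ E] [FiniteDimensional ℝ E]

lemma exists_nhds_slice_bound (hU : IsOpen U) (hΨ : ContinuousOn Ψ (U ×ˢ Iio b))
    {p₀ : E} (hp : p₀ ∈ U) {c : ℝ} (hc : c < b) :
    ∃ K ∈ 𝓝 p₀, K ⊆ U ∧ ∃ M, ∀ p ∈ K, ∀ s ∈ Icc (-1) c, ‖Ψ (p, s)‖ ≤ M := by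
  have : ProperSpace E := FiniteDimensional.proper ℝ E
  obtain ⟨K, hK, hKU, hKc⟩ := local_compact_nhds (hU.mem_nhds hp)
  obtain ⟨M, hM⟩ := (hKc.prod (isCompact_Icc (a := (-1 : ℝ)) (b := c))).exists_bound_of_continuousOn
    (hΨ.mono (prod_mono hKU fun s hs => lt_of_le_of_lt hs.2 hc))
  exact ⟨K, hK, hKU, M, fun p hp s hs => hM (p, s) ⟨hp, hs⟩⟩

variable [NormedSpace ℝ F]

lemma continuousAt_parametric_primitive (hU : IsOpen U) (hb : 0 < b)
    (hf : ∀ c < b, IntervalIntegrable f volume (-1) c) (hΨ : ContinuousOn Ψ (U ×ˢ Iio b))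
    {p₀ : E} (hp : p₀ ∈ U) {a₀ : ℝ} (ha : a₀ ∈ Ioo (-1) b) :
    ContinuousAt (fun q : E × ℝ => ∫ s in (0 : ℝ)..q.2, f s • Ψ (q.1, s)) (p₀, a₀) := by
  classical
  obtain ⟨c, hc, hcb⟩ := exists_between (max_lt ha.2 hb)
  have hac : a₀ < c := (le_max_left _ _).trans_lt hc
  have h0c : 0 < c := (le_max_right _ _).trans_lt hc
  obtain ⟨K, hK, hKU, M, hM⟩ := exists_nhds_slice_bound hU hΨ hp hcb
  have hI : uIoc (-1) c ⊆ Icc (-1) c := by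
    rw [uIoc_of_le (by linarith : (-1 : ℝ) ≤ c)]; exact Ioc_subset_Icc_self
  have key := intervalIntegral.continuousAt_parametric_primitive_of_dominated (μ := volume)
    (F := fun p s => if p ∈ U then f s • Ψ (p, s) else 0) (fun s => |f s| * M) (-1) c
    (a₀ := 0) (b₀ := a₀) (x₀ := p₀) ?_ ?_ ?_ ?_ ⟨by norm_num, h0c⟩ ⟨ha.1, hac⟩ (by simp)
  · refine key.congr ?_
    have : ∀ᶠ q : E × ℝ in 𝓝 (p₀, a₀), q.1 ∈ U := continuousAt_fst (hU.mem_nhds hp)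
    filter_upwards [this] with q hq
    simp [hq]
  · intro p
    by_cases h : p ∈ U
    · simpa [h] using
        (intervalIntegrable_smul_slice hf hΨ h (by linarith) hcb).aestronglyMeasurable_restrict_uIoc
    · simp only [h, if_false]; exact aestronglyMeasurable_const
  · filter_upwards [hK] with p hpK
    refine (ae_restrict_iff' measurableSet_uIoc).2 (ae_of_all _ fun s hs => ?_)
    simp only [hKU hpK, if_true, norm_smul, Real.norm_eq_abs]
    exact mul_le_mul_of_nonneg_left (hM p hpK s (hI hs)) (abs_nonneg _)
  · exact (hf c hcb).abs.mul_const M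
  · refine (ae_restrict_iff' measurableSet_uIoc).2 (ae_of_all _ fun s hs => ?_)
    have hΨs : ContinuousAt Ψ (p₀, s) :=
      hΨ.continuousAt ((hU.prod isOpen_Iio).mem_nhds ⟨hp, (hI hs).2.trans_lt hcb⟩)
    have h1 : ContinuousAt (fun p => f s • Ψ (p, s)) p₀ :=
      continuousAt_const.smul (ContinuousAt.comp (g := Ψ) (f := fun p => (p, s)) hΨs (by fun_prop))
    refine h1.congr ?_
    filter_upwards [hU.mem_nhds hp] with p hp
    simp [hp]

lemma hasFDerivAt_parametric_integral [CompleteSpace F] (hU : IsOpen U) (hb : 0 < b)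
    (hf : ∀ c < b, IntervalIntegrable f volume (-1) c) (hΨ : ContinuousOn Ψ (U ×ˢ Iio b))
    {Ψ' : E × ℝ → E →L[ℝ] F} (hΨ' : ContinuousOn Ψ' (U ×ˢ Iio b))
    (hd : ∀ p ∈ U, ∀ s < b, HasFDerivAt (fun p => Ψ (p, s)) (Ψ' (p, s)) p)
    {p₀ : E} (hp : p₀ ∈ U) {a : ℝ} (ha : a ∈ Ioo (-1) b) :
    HasFDerivAt (fun p => ∫ s in (0 : ℝ)..a, f s • Ψ (p, s))
      (∫ s in (0 : ℝ)..a, f s • Ψ' (p₀, s)) p₀ := by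
  obtain ⟨K, hK, hKU, M, hM⟩ := exists_nhds_slice_bound hU hΨ' hp (max_lt ha.2 hb)
  have hI : uIoc 0 a ⊆ Icc (-1) (max a 0) := by
    intro s hs
    rw [mem_uIoc] at hs
    have := ha.1
    rcases hs with hs | hs
    · exact ⟨by linarith [hs.1], le_max_of_le_left hs.2⟩
    · exact ⟨by linarith [hs.1], le_max_of_le_right hs.2⟩
  have hint : ∀ p ∈ U, IntervalIntegrable (fun s => f s • Ψ (p, s)) volume 0 a := fun p hp =>
    intervalIntegrable_smul_slice hf hΨ hp hb ha.2
  refine intervalIntegral.hasFDerivAt_integral_of_dominated_of_fderiv_le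
    (F := fun p s => f s • Ψ (p, s)) (F' := fun p s => f s • Ψ' (p, s))
    (bound := fun s => |f s| * M) hK ?_ (hint p₀ hp) ?_ ?_ ?_ ?_
  · filter_upwards [hU.mem_nhds hp] with p hp using (hint p hp).aestronglyMeasurable_restrict_uIoc
  · exact (intervalIntegrable_smul_slice hf hΨ' hp hb ha.2).aestronglyMeasurable_restrict_uIoc
  · refine ae_of_all _ fun s hs p hpK => ?_
    rw [norm_smul, Real.norm_eq_abs]
    exact mul_le_mul_of_nonneg_left (hM p hpK s (hI hs)) (abs_nonneg _)
  · exact ((hf 0 hb).symm.trans (hf a ha.2)).abs.mul_const M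
  · refine ae_of_all _ fun s hs p hpK => ?_
    exact (hd p (hKU hpK) s ((hI hs).2.trans_lt (max_lt ha.2 hb))).const_smul (f s)

lemma hasFDerivAt_parametric_primitive [CompleteSpace F] (hU : IsOpen U) (hb : 0 < b)
    (hf : ∀ c < b, IntervalIntegrable f volume (-1) c) (hfc : ContinuousOn f (Ioo 0 b))
    (hΨ : ContinuousOn Ψ (U ×ˢ Iio b))
    {Ψ' : E × ℝ → E →L[ℝ] F} (hΨ' : ContinuousOn Ψ' (U ×ˢ Iio b))
    (hd : ∀ p ∈ U, ∀ s < b, HasFDerivAt (fun p => Ψ (p, s)) (Ψ' (p, s)) p)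
    {q : E × ℝ} (hq : q ∈ U ×ˢ Ioo 0 b) :
    HasFDerivAt (fun q : E × ℝ => ∫ s in (0 : ℝ)..q.2, f s • Ψ (q.1, s))
      ((∫ s in (0 : ℝ)..q.2, f s • Ψ' (q.1, s)).coprod
        (ContinuousLinearMap.toSpanSingleton ℝ (f q.2 • Ψ q))) q := by
  have hopen : U ×ˢ Ioo 0 b ∈ 𝓝 q := (hU.prod isOpen_Ioo).mem_nhds hq
  have hcont : ContinuousOn (fun q : E × ℝ => f q.2 • Ψ q) (U ×ˢ Ioo 0 b) :=
    (hfc.comp continuousOn_snd fun q hq => hq.2).smul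
      (hΨ.mono (prod_mono subset_rfl fun s hs => hs.2))
  refine (hasStrictFDerivAt_uncurry_coprod
    (f := fun p a => ∫ s in (0 : ℝ)..a, f s • Ψ (p, s))
    (f₁ := fun p a => ∫ s in (0 : ℝ)..a, f s • Ψ' (p, s))
    (f₂ := fun p a => ContinuousLinearMap.toSpanSingleton ℝ (f a • Ψ (p, a)))
    ?_ ?_ ?_ ?_).hasFDerivAt
  · filter_upwards [hopen] with v hv
    exact hasFDerivAt_parametric_integral hU hb hf hΨ hΨ' hd hv.1 ⟨by linarith [hv.2.1], hv.2.2⟩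
  · filter_upwards [hopen] with v hv
    have hat : ∀ a ∈ Ioo 0 b, ContinuousAt (fun s => f s • Ψ (v.1, s)) a := fun a ha =>
      ContinuousAt.comp (g := fun q : E × ℝ => f q.2 • Ψ q) (f := fun s => (v.1, s))
        (hcont.continuousAt ((hU.prod isOpen_Ioo).mem_nhds ⟨hv.1, ha⟩)) (by fun_prop)
    refine (intervalIntegral.integral_hasDerivAt_right
      (intervalIntegrable_smul_slice hf hΨ hv.1 hb hv.2.2)
      ?_ (hat _ hv.2)).hasFDerivAt
    exact ContinuousAt.stronglyMeasurableAtFilter isOpen_Ioo hat _ hv.2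
  · exact continuousAt_parametric_primitive hU hb hf hΨ' hq.1 ⟨by linarith [hq.2.1], hq.2.2⟩
  · exact (ContinuousLinearMap.toSpanSingletonCLE (𝕜 := ℝ) (E := F)).continuous.continuousAt.comp
      (hcont.continuousAt hopen)

lemma contDiffOn_parametric_primitive {F : Type} [NormedAddCommGroup F] [NormedSpace ℝ F]
    [CompleteSpace F] {Ψ : E × ℝ → F} (hU : IsOpen U) (hb : 0 < b)
    (hf : ∀ c < b, IntervalIntegrable f volume (-1) c) {k : ℕ} (hfk : ContDiffOn ℝ k f (Ioo 0 b))
    (hΨ : ∀ m : ℕ, ContDiffOn ℝ m Ψ (U ×ˢ Iio b)) {j : ℕ} (hj : j ≤ k + 1) :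
    ContDiffOn ℝ j (fun q : E × ℝ => ∫ s in (0 : ℝ)..q.2, f s • Ψ (q.1, s)) (U ×ˢ Ioo 0 b) := by
  induction j generalizing F with
  | zero =>
    rw [Nat.cast_zero, contDiffOn_zero]
    exact fun q hq => (continuousAt_parametric_primitive hU hb hf (hΨ 0).continuousOn hq.1
      ⟨by linarith [hq.2.1], hq.2.2⟩).continuousWithinAt
  | succ j ih =>
    have hopen : IsOpen (U ×ˢ Iio b) := hU.prod isOpen_Iio
    let Ψ' : E × ℝ → E →L[ℝ] F := fun q => (fderiv ℝ Ψ q).comp (ContinuousLinearMap.inl ℝ E ℝ)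
    have hΨ' : ∀ m : ℕ, ContDiffOn ℝ m Ψ' (U ×ˢ Iio b) := fun m =>
      ((hΨ (m + 1)).fderiv_of_isOpen hopen (by norm_cast)).clm_comp contDiffOn_const
    have hd : ∀ p ∈ U, ∀ s < b, HasFDerivAt (fun p => Ψ (p, s)) (Ψ' (p, s)) p := by
      intro p hp s hs
      have h1 : HasFDerivAt Ψ (fderiv ℝ Ψ (p, s)) (p, s) :=
        (((hΨ 1).contDiffAt (hopen.mem_nhds (mk_mem_prod hp hs))).differentiableAt
          (by simp)).hasFDerivAt
      exact h1.comp p (hasFDerivAt_prodMk_left p s)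
    rw [Nat.cast_succ, contDiffOn_succ_iff_hasFDerivWithinAt_of_uniqueDiffOn
      (hU.prod isOpen_Ioo).uniqueDiffOn]
    refine ⟨by simp, _, ?_, fun q hq => (hasFDerivAt_parametric_primitive hU hb hf
      hfk.continuousOn (hΨ 0).continuousOn (hΨ' 0).continuousOn hd hq).hasFDerivWithinAt⟩
    simp only [← ContinuousLinearMap.comp_fst_add_comp_snd]
    refine ((ih hΨ' (by omega)).clm_comp contDiffOn_const).add
      (ContDiffOn.clm_comp ?_ contDiffOn_const)
    refine (ContinuousLinearMap.toSpanSingletonCLE (𝕜 := ℝ) (E := F)).contDiff.comp_contDiffOn ?_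
    exact ((hfk.of_le (by exact_mod_cast (by omega : j ≤ k))).comp contDiffOn_snd
      fun q hq => hq.2).smul ((hΨ j).mono (prod_mono subset_rfl fun s hs => hs.2))

end ParametricPrimitive

section OneParameter

variable {U : Set ℝ} {b : ℝ} {f : ℝ → ℝ} {Ψ Ψ' : ℝ × ℝ → ℝ}

lemma hasDerivAt_parametric_integral (hU : IsOpen U) (hb : 0 < b)
    (hf : ∀ c < b, IntervalIntegrable f volume (-1) c) (hΨ : ContinuousOn Ψ (U ×ˢ Iio b))
    (hΨ' : ContinuousOn Ψ' (U ×ˢ Iio b))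
    (hd : ∀ p ∈ U, ∀ s < b, HasDerivAt (fun p => Ψ (p, s)) (Ψ' (p, s)) p)
    {p₀ : ℝ} (hp : p₀ ∈ U) {a : ℝ} (ha : a ∈ Ioo (-1) b) :
    HasDerivAt (fun p => ∫ s in (0 : ℝ)..a, f s * Ψ (p, s))
      (∫ s in (0 : ℝ)..a, f s * Ψ' (p₀, s)) p₀ := by
  have hΨ'' : ContinuousOn (fun q => ContinuousLinearMap.toSpanSingleton ℝ (Ψ' q)) (U ×ˢ Iio b) :=
    (ContinuousLinearMap.toSpanSingletonCLE (𝕜 := ℝ) (E := ℝ)).continuous.comp_continuousOn hΨ'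
  have h := (hasFDerivAt_parametric_integral hU hb hf hΨ hΨ''
    (fun p hp s hs => (hd p hp s hs).hasFDerivAt) hp ha).hasDerivAt
  rw [ContinuousLinearMap.intervalIntegral_apply
    (intervalIntegrable_smul_slice hf hΨ'' hp hb ha.2)] at h
  simpa using h

lemma hasDerivAt_parametric_primitive_diag (hU : IsOpen U) (hb : 0 < b)
    (hf : ∀ c < b, IntervalIntegrable f volume (-1) c) (hfc : ContinuousOn f (Ioo 0 b))
    (hΨ : ContinuousOn Ψ (U ×ˢ Iio b)) (hΨ' : ContinuousOn Ψ' (U ×ˢ Iio b))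
    (hd : ∀ p ∈ U, ∀ s < b, HasDerivAt (fun p => Ψ (p, s)) (Ψ' (p, s)) p)
    {x : ℝ} (hx : x ∈ U) (hx' : x ∈ Ioo 0 b) :
    HasDerivAt (fun p => ∫ s in (0 : ℝ)..p, f s * Ψ (p, s))
      ((∫ s in (0 : ℝ)..x, f s * Ψ' (x, s)) + f x * Ψ (x, x)) x := by
  have hΨ'' : ContinuousOn (fun q => ContinuousLinearMap.toSpanSingleton ℝ (Ψ' q)) (U ×ˢ Iio b) :=
    (ContinuousLinearMap.toSpanSingletonCLE (𝕜 := ℝ) (E := ℝ)).continuous.comp_continuousOn hΨ'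
  have h := hasFDerivAt_parametric_primitive hU hb hf hfc hΨ hΨ''
    (fun p hp s hs => (hd p hp s hs).hasFDerivAt) (q := (x, x)) ⟨hx, hx'⟩
  have h2 := h.comp_hasDerivAt (f := fun t : ℝ => (t, t)) x
    ((hasDerivAt_id x).prodMk (hasDerivAt_id x))
  simp only [ContinuousLinearMap.coprod_apply] at h2
  rw [ContinuousLinearMap.intervalIntegral_apply
    (intervalIntegrable_smul_slice hf hΨ'' hx hb hx'.2)] at h2
  simpa [Function.comp_def] using h2

end OneParameter

section Kernel

/-- The points `(k, y)` with `k < 1` and `k + y < 1`. -/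
def profileDomain : Set (ℝ × ℝ) := {p | p.1 < 1 ∧ p.1 + p.2 < 1}

/-- The points `((x, y), s)` for which both `(x, y)` and `(s, y)` lie in `profileDomain`. -/
def kernelDomain : Set ((ℝ × ℝ) × ℝ) :=
  {q | (q.1.1 < 1 ∧ q.2 < 1) ∧ q.1.1 + q.1.2 < 1 ∧ q.2 + q.1.2 < 1}

lemma isOpen_kernelDomain : IsOpen kernelDomain := by
  simp only [kernelDomain, ofPred_and]
  exact ((isOpen_lt (by fun_prop) (by fun_prop)).inter
    (isOpen_lt (by fun_prop) (by fun_prop))).inter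
    ((isOpen_lt (by fun_prop) (by fun_prop)).inter (isOpen_lt (by fun_prop) (by fun_prop)))

/-- The point of the segment between `s` and `x` with weight `sin² θ`. -/
def segPoint (x s θ : ℝ) : ℝ := s + (x - s) * Real.sin θ ^ 2

lemma segPoint_mem {x y s : ℝ} (h : ((x, y), s) ∈ kernelDomain) (θ : ℝ) :
    (segPoint x s θ, y) ∈ profileDomain := by
  obtain ⟨⟨h1, h2⟩, h3, h4⟩ := h
  dsimp only at h1 h2 h3 h4
  have hle : segPoint x s θ ≤ max x s := by
    have h5 := Real.sin_sq_add_cos_sq θ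
    have : segPoint x s θ = Real.sin θ ^ 2 * x + Real.cos θ ^ 2 * s := by
      unfold segPoint; linear_combination -s * h5
    rw [this]
    calc _ ≤ Real.sin θ ^ 2 * max x s + Real.cos θ ^ 2 * max x s := by
            gcongr; exacts [le_max_left _ _, le_max_right _ _]
      _ = max x s := by linear_combination max x s * h5
  constructor
  · exact hle.trans_lt (max_lt h1 h2)
  · have : max x s < 1 - y := max_lt (by linarith) (by linarith)
    show segPoint x s θ + y < 1
    linarith

/-- Weighted average of the profile `h` over the segment between `s` and `x`. -/
def segAverage (w : ℝ → ℝ) (h : ℝ → ℝ → ℝ) (x y s : ℝ) : ℝ :=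
  Real.pi⁻¹ * ∫ θ in (0 : ℝ)..Real.pi, w θ * h (segPoint x s θ) y

variable {w : ℝ → ℝ} {h hk hy : ℝ → ℝ → ℝ}

lemma pi_mem : Real.pi ∈ Ioo (-1 : ℝ) 4 := ⟨by linarith [Real.pi_pos], Real.pi_lt_four⟩

lemma contDiffOn_segAverage (hw : ContDiff ℝ ⊤ w)
    (hh : ∀ m : ℕ, ContDiffOn ℝ m (fun p : ℝ × ℝ => h p.1 p.2) profileDomain) (m : ℕ) :
    ContDiffOn ℝ m (fun q : (ℝ × ℝ) × ℝ => segAverage w h q.1.1 q.1.2 q.2) kernelDomain := by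
  have key := contDiffOn_parametric_primitive (b := 4) (f := w) (k := m) (j := m)
    (Ψ := fun r : ((ℝ × ℝ) × ℝ) × ℝ => h (segPoint r.1.1.1 r.1.2 r.2) r.1.1.2)
    isOpen_kernelDomain (by norm_num) (fun c _ => hw.continuous.intervalIntegrable _ _)
    ((hw.of_le le_top).contDiffOn) (fun m => ?_) (by omega)
  · refine contDiffOn_const.mul ?_
    exact key.comp (f := fun q => (q, Real.pi)) (contDiffOn_id.prodMk contDiffOn_const)
      fun q hq => ⟨hq, Real.pi_pos, Real.pi_lt_four⟩
  · refine (hh m).comp (f := fun r : ((ℝ × ℝ) × ℝ) × ℝ => (segPoint r.1.1.1 r.1.2 r.2, r.1.1.2))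
      (ContDiff.contDiffOn ?_) fun r hr => segPoint_mem hr.1 _
    unfold segPoint
    have := Real.contDiff_sin (n := m)
    fun_prop

lemma hasDerivAt_segAverage_left (hw : Continuous w)
    (hh : ContinuousOn (fun p : ℝ × ℝ => h p.1 p.2) profileDomain)
    (hhk : ContinuousOn (fun p : ℝ × ℝ => hk p.1 p.2) profileDomain)
    (hd : ∀ p ∈ profileDomain, HasDerivAt (fun k => h k p.2) (hk p.1 p.2) p.1)
    {x y s : ℝ} (hq : ((x, y), s) ∈ kernelDomain) :
    HasDerivAt (fun x => segAverage w h x y s)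
      (segAverage (fun θ => w θ * Real.sin θ ^ 2) hk x y s) x := by
  have hopen : IsOpen {x : ℝ | ((x, y), s) ∈ kernelDomain} :=
    isOpen_kernelDomain.preimage (by fun_prop)
  have hmaps : MapsTo (fun r : ℝ × ℝ => (segPoint r.1 s r.2, y))
      ({x : ℝ | ((x, y), s) ∈ kernelDomain} ×ˢ Iio 4) profileDomain :=
    fun r hr => segPoint_mem hr.1 _
  have hcont : Continuous (fun r : ℝ × ℝ => (segPoint r.1 s r.2, y)) := by
    unfold segPoint; fun_prop
  have key := hasDerivAt_parametric_integral (b := 4) (f := w)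
    (Ψ := fun r => h (segPoint r.1 s r.2) y)
    (Ψ' := fun r => Real.sin r.2 ^ 2 * hk (segPoint r.1 s r.2) y) hopen (by norm_num)
    (fun c _ => hw.intervalIntegrable _ _) (hh.comp hcont.continuousOn hmaps)
    (ContinuousOn.mul (by fun_prop) (hhk.comp hcont.continuousOn hmaps)) ?_ hq pi_mem
  · simpa only [segAverage, mul_assoc] using key.const_mul Real.pi⁻¹
  · intro p hp θ _
    have h1 : HasDerivAt (fun x => segPoint x s θ) (Real.sin θ ^ 2) p := by
      simpa [segPoint] using
        (((hasDerivAt_id p).sub_const s).mul_const (Real.sin θ ^ 2)).const_add s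
    have h2 := (hd _ (segPoint_mem hp θ)).comp p h1
    rwa [mul_comm] at h2

lemma hasDerivAt_segAverage_right (hw : Continuous w)
    (hh : ContinuousOn (fun p : ℝ × ℝ => h p.1 p.2) profileDomain)
    (hhy : ContinuousOn (fun p : ℝ × ℝ => hy p.1 p.2) profileDomain)
    (hd : ∀ p ∈ profileDomain, HasDerivAt (fun y => h p.1 y) (hy p.1 p.2) p.2)
    {x y s : ℝ} (hq : ((x, y), s) ∈ kernelDomain) :
    HasDerivAt (fun y => segAverage w h x y s) (segAverage w hy x y s) y := by
  have hopen : IsOpen {y : ℝ | ((x, y), s) ∈ kernelDomain} :=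
    isOpen_kernelDomain.preimage (by fun_prop)
  have hmaps : MapsTo (fun r : ℝ × ℝ => (segPoint x s r.2, r.1))
      ({y : ℝ | ((x, y), s) ∈ kernelDomain} ×ˢ Iio 4) profileDomain :=
    fun r hr => segPoint_mem hr.1 _
  have hcont : Continuous (fun r : ℝ × ℝ => (segPoint x s r.2, r.1)) := by
    unfold segPoint; fun_prop
  exact (hasDerivAt_parametric_integral (b := 4) (f := w)
    (Ψ := fun r => h (segPoint x s r.2) r.1) (Ψ' := fun r => hy (segPoint x s r.2) r.1)
    hopen (by norm_num) (fun c _ => hw.intervalIntegrable _ _)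
    (hh.comp hcont.continuousOn hmaps) (hhy.comp hcont.continuousOn hmaps)
    (fun p hp θ _ => hd _ (segPoint_mem hp θ)) hq pi_mem).const_mul Real.pi⁻¹

lemma segAverage_one_diag (h : ℝ → ℝ → ℝ) (x y : ℝ) :
    segAverage (fun _ => 1) h x y x = h x y := by
  simp [segAverage, segPoint, Real.pi_ne_zero]

end Kernel

section Profile

/-- The profile `√(1 - k) / √(1 - y - k)`. -/
def profile (k y : ℝ) : ℝ := √(1 - k) / √(1 - y - k)

/-- The derivative of `profile` in `y`. -/
def profileY (k y : ℝ) : ℝ := profile k y / (2 * (1 - y - k))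

/-- The derivative of `profile` in `k`. -/
def profileK (k y : ℝ) : ℝ := profile k y * (1 / (2 * (1 - y - k)) - 1 / (2 * (1 - k)))

/-- The mixed derivative of `profile`. -/
def profileKY (k y : ℝ) : ℝ :=
  profileK k y / (2 * (1 - y - k)) + profile k y / (2 * (1 - y - k) ^ 2)

lemma profileDomain_pos {k y : ℝ} (h : (k, y) ∈ profileDomain) : 0 < 1 - k ∧ 0 < 1 - y - k :=
  ⟨by linarith [h.1], by linarith [h.2]⟩

lemma contDiffOn_profile (m : ℕ) :
    ContDiffOn ℝ m (fun p : ℝ × ℝ => profile p.1 p.2) profileDomain := by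
  refine ContDiffOn.div (ContDiffOn.sqrt (by fun_prop) fun p hp => (profileDomain_pos hp).1.ne')
    (ContDiffOn.sqrt (by fun_prop) fun p hp => (profileDomain_pos hp).2.ne') fun p hp => ?_
  exact (Real.sqrt_pos.2 (profileDomain_pos hp).2).ne'

lemma contDiffOn_profileY (m : ℕ) :
    ContDiffOn ℝ m (fun p : ℝ × ℝ => profileY p.1 p.2) profileDomain :=
  (contDiffOn_profile m).div (by fun_prop) fun p hp => by
    have := (profileDomain_pos hp).2; positivity

lemma contDiffOn_profileK (m : ℕ) :
    ContDiffOn ℝ m (fun p : ℝ × ℝ => profileK p.1 p.2) profileDomain := by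
  refine (contDiffOn_profile m).mul (ContDiffOn.sub
    (contDiffOn_const.div (by fun_prop) fun p hp => ?_)
    (contDiffOn_const.div (by fun_prop) fun p hp => ?_))
  · have := (profileDomain_pos hp).2; positivity
  · have := (profileDomain_pos hp).1; positivity

lemma contDiffOn_profileKY (m : ℕ) :
    ContDiffOn ℝ m (fun p : ℝ × ℝ => profileKY p.1 p.2) profileDomain := by
  refine ((contDiffOn_profileK m).div (by fun_prop) fun p hp => ?_).add
    ((contDiffOn_profile m).div (by fun_prop) fun p hp => ?_)
  all_goals have := (profileDomain_pos hp).2; positivity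

lemma hasDerivAt_profile_right {p : ℝ × ℝ} (hp : p ∈ profileDomain) :
    HasDerivAt (fun y => profile p.1 y) (profileY p.1 p.2) p.2 := by
  obtain ⟨k, y⟩ := p
  obtain ⟨h1, h2⟩ := profileDomain_pos hp
  have hs : 0 < √(1 - y - k) := Real.sqrt_pos.2 h2
  have h := (hasDerivAt_const y (√(1 - k))).div
    ((((hasDerivAt_id y).const_sub 1).sub_const k).sqrt h2.ne') hs.ne'
  refine h.congr_deriv ?_
  have hsq : 1 - y - k = √(1 - y - k) ^ 2 := (Real.sq_sqrt h2.le).symm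
  simp only [id, profileY, profile]
  generalize √(1 - y - k) = A at *
  rw [hsq]
  field_simp
  ring

lemma hasDerivAt_profile_left {p : ℝ × ℝ} (hp : p ∈ profileDomain) :
    HasDerivAt (fun k => profile k p.2) (profileK p.1 p.2) p.1 := by
  obtain ⟨k, y⟩ := p
  obtain ⟨h1, h2⟩ := profileDomain_pos hp
  have hs : 0 < √(1 - y - k) := Real.sqrt_pos.2 h2
  have hs1 : 0 < √(1 - k) := Real.sqrt_pos.2 h1
  have h := (((hasDerivAt_id k).const_sub 1).sqrt h1.ne').div
    (((hasDerivAt_id k).const_sub (1 - y)).sqrt h2.ne') hs.ne'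
  refine h.congr_deriv ?_
  have hsq : 1 - y - k = √(1 - y - k) ^ 2 := (Real.sq_sqrt h2.le).symm
  have hsq1 : 1 - k = √(1 - k) ^ 2 := (Real.sq_sqrt h1.le).symm
  simp only [id, profileK, profile]
  generalize √(1 - y - k) = A at *
  generalize √(1 - k) = B at *
  rw [hsq, hsq1]
  field_simp
  ring

lemma hasDerivAt_profileY_left {p : ℝ × ℝ} (hp : p ∈ profileDomain) :
    HasDerivAt (fun k => profileY k p.2) (profileKY p.1 p.2) p.1 := by
  have h0 := hasDerivAt_profile_left hp
  obtain ⟨k, y⟩ := p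
  obtain ⟨h1, h2⟩ := profileDomain_pos hp
  have h := h0.div (((hasDerivAt_id k).const_sub (1 - y)).const_mul 2)
    (by simpa using h2.ne')
  refine h.congr_deriv ?_
  simp only [id, profileKY]
  field_simp
  ring

lemma hasDerivAt_profileK_right {p : ℝ × ℝ} (hp : p ∈ profileDomain) :
    HasDerivAt (fun y => profileK p.1 y) (profileKY p.1 p.2) p.2 := by
  have h0 := hasDerivAt_profile_right hp
  obtain ⟨k, y⟩ := p
  obtain ⟨h1, h2⟩ := profileDomain_pos hp
  have h := h0.mul (((hasDerivAt_const y (1 : ℝ)).div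
    ((((hasDerivAt_id y).const_sub 1).sub_const k).const_mul 2)
    (by simpa using h2.ne')).sub_const (1 / (2 * (1 - k))))
  refine h.congr_deriv ?_
  simp only [id, profileKY, profileK, profileY, Pi.div_apply]
  field_simp
  ring

end Profile

section RiemannKernel

/-- The Euler–Darboux solution generated by a unit jump of the datum at `s`. -/
def edKernel : ℝ → ℝ → ℝ → ℝ := segAverage (fun _ => 1) profile

/-- The derivative of `edKernel` in `x`. -/
def edKernelX : ℝ → ℝ → ℝ → ℝ := segAverage (fun θ => Real.sin θ ^ 2) profileK

/-- The derivative of `edKernel` in `y`. -/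
def edKernelY : ℝ → ℝ → ℝ → ℝ := segAverage (fun _ => 1) profileY

/-- The mixed derivative of `edKernel`. -/
def edKernelXY : ℝ → ℝ → ℝ → ℝ := segAverage (fun θ => Real.sin θ ^ 2) profileKY

lemma contDiffOn_edKernel (m : ℕ) :
    ContDiffOn ℝ m (fun q : (ℝ × ℝ) × ℝ => edKernel q.1.1 q.1.2 q.2) kernelDomain :=
  contDiffOn_segAverage contDiff_const contDiffOn_profile m

lemma continuousOn_edKernelX :
    ContinuousOn (fun q : (ℝ × ℝ) × ℝ => edKernelX q.1.1 q.1.2 q.2) kernelDomain :=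
  (contDiffOn_segAverage (Real.contDiff_sin.pow 2) contDiffOn_profileK 0).continuousOn

lemma continuousOn_edKernelY :
    ContinuousOn (fun q : (ℝ × ℝ) × ℝ => edKernelY q.1.1 q.1.2 q.2) kernelDomain :=
  (contDiffOn_segAverage contDiff_const contDiffOn_profileY 0).continuousOn

lemma continuousOn_edKernelXY :
    ContinuousOn (fun q : (ℝ × ℝ) × ℝ => edKernelXY q.1.1 q.1.2 q.2) kernelDomain :=
  (contDiffOn_segAverage (Real.contDiff_sin.pow 2) contDiffOn_profileKY 0).continuousOn

variable {x y s : ℝ}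

lemma hasDerivAt_edKernel_left (hq : ((x, y), s) ∈ kernelDomain) :
    HasDerivAt (fun x => edKernel x y s) (edKernelX x y s) x := by
  simpa only [edKernel, edKernelX, one_mul] using
    hasDerivAt_segAverage_left (w := fun _ => 1) continuous_const
    (contDiffOn_profile 0).continuousOn (contDiffOn_profileK 0).continuousOn
    (fun p hp => hasDerivAt_profile_left hp) hq

lemma hasDerivAt_edKernelY_left (hq : ((x, y), s) ∈ kernelDomain) :
    HasDerivAt (fun x => edKernelY x y s) (edKernelXY x y s) x := by
  simpa only [edKernelY, edKernelXY, one_mul] using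
    hasDerivAt_segAverage_left (w := fun _ => 1) continuous_const
    (contDiffOn_profileY 0).continuousOn (contDiffOn_profileKY 0).continuousOn
    (fun p hp => hasDerivAt_profileY_left hp) hq

lemma hasDerivAt_edKernel_right (hq : ((x, y), s) ∈ kernelDomain) :
    HasDerivAt (fun y => edKernel x y s) (edKernelY x y s) y :=
  hasDerivAt_segAverage_right continuous_const
    (contDiffOn_profile 0).continuousOn (contDiffOn_profileY 0).continuousOn
    (fun _ hp => hasDerivAt_profile_right hp) hq

lemma hasDerivAt_edKernelX_right (hq : ((x, y), s) ∈ kernelDomain) :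
    HasDerivAt (fun y => edKernelX x y s) (edKernelXY x y s) y :=
  hasDerivAt_segAverage_right (by fun_prop)
    (contDiffOn_profileK 0).continuousOn (contDiffOn_profileKY 0).continuousOn
    (fun p hp => hasDerivAt_profileK_right hp) hq

lemma edKernel_diag (x y : ℝ) : edKernel x y x = profile x y := segAverage_one_diag _ _ _

lemma edKernelY_diag (x y : ℝ) : edKernelY x y x = edKernel x y x / (2 * (1 - x - y)) := by
  rw [edKernel_diag, edKernelY, segAverage_one_diag, profileY, sub_right_comm]

lemma edKernel_zero_right (hx : x < 1) (hs : s < 1) : edKernel x 0 s = 1 := by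
  have h : ∀ θ, profile (segPoint x s θ) 0 = 1 := by
    intro θ
    have h1 := (profileDomain_pos (segPoint_mem (y := 0) (x := x) (s := s)
      ⟨⟨hx, hs⟩, by simpa using hx, by simpa using hs⟩ θ)).1
    simp [profile, (Real.sqrt_pos.2 h1).ne']
  simp [edKernel, segAverage, h, Real.pi_ne_zero]

/-- The residual of the Euler–Darboux equation integrates to zero because it is the `θ`-derivative
of `-sin θ cos θ · profileY`. -/
lemma edKernel_eulerDarboux (hq : ((x, y), s) ∈ kernelDomain) :
    edKernelXY x y s = (edKernelX x y s + edKernelY x y s) / (2 * (1 - x - y)) := by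
  have hxy : 0 < 1 - x - y := by have := hq.2.1; dsimp only at this; linarith
  have hseg : Continuous fun θ => (segPoint x s θ, y) := by unfold segPoint; fun_prop
  have hcont : ∀ g : ℝ → ℝ → ℝ, ContinuousOn (fun p : ℝ × ℝ => g p.1 p.2) profileDomain →
      Continuous fun θ => g (segPoint x s θ) y := fun g hg =>
    hg.comp_continuous hseg (segPoint_mem hq)
  have cK := hcont _ (contDiffOn_profileK 0).continuousOn
  have cY := hcont _ (contDiffOn_profileY 0).continuousOn
  have cKY := hcont _ (contDiffOn_profileKY 0).continuousOn
  have hderiv : ∀ θ ∈ uIcc 0 Real.pi, HasDerivAt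
      (fun θ => -(Real.sin θ * Real.cos θ * profileY (segPoint x s θ) y))
      (2 * (1 - x - y) * (Real.sin θ ^ 2 * profileKY (segPoint x s θ) y)
        - (Real.sin θ ^ 2 * profileK (segPoint x s θ) y + 1 * profileY (segPoint x s θ) y)) θ := by
    intro θ _
    have h1 : HasDerivAt (fun θ => segPoint x s θ)
        ((x - s) * (2 * Real.sin θ * Real.cos θ)) θ := by
      have := ((((Real.hasDerivAt_sin θ).pow 2).const_mul (x - s)).const_add s)
      simpa [segPoint] using this
    have h2 := (hasDerivAt_profileY_left (segPoint_mem hq θ)).comp θ h1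
    have h3 := (((Real.hasDerivAt_sin θ).mul (Real.hasDerivAt_cos θ)).mul h2).neg
    refine h3.congr_deriv ?_
    have hw := (profileDomain_pos (segPoint_mem hq θ)).2
    have hsc := Real.cos_sq' θ
    have hx : 1 - x - y = (1 - y - segPoint x s θ) - (x - s) * (1 - Real.sin θ ^ 2) := by
      unfold segPoint; ring
    have e1 : 2 * (1 - y - segPoint x s θ) * profileKY (segPoint x s θ) y
        = profileK (segPoint x s θ) y + 2 * profileY (segPoint x s θ) y := by
      unfold profileKY profileY; field_simp
    rw [hx]
    simp only [Function.comp, Pi.mul_apply]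
    generalize profileKY (segPoint x s θ) y = A at *
    generalize profileK (segPoint x s θ) y = B at *
    generalize profileY (segPoint x s θ) y = C at *
    linear_combination (-Real.sin θ ^ 2) * e1
      + (-C - 2 * (x - s) * Real.sin θ ^ 2 * A) * hsc
  have hint := intervalIntegral.integral_eq_sub_of_hasDerivAt hderiv
    (Continuous.intervalIntegrable (by fun_prop) _ _)
  rw [intervalIntegral.integral_sub (Continuous.intervalIntegrable (by fun_prop) _ _)
      (Continuous.intervalIntegrable (by fun_prop) _ _),
    intervalIntegral.integral_add (Continuous.intervalIntegrable (by fun_prop) _ _)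
      (Continuous.intervalIntegrable (by fun_prop) _ _),
    intervalIntegral.integral_const_mul] at hint
  simp only [Real.sin_pi, Real.sin_zero, zero_mul, neg_zero, sub_zero] at hint
  rw [eq_div_iff (by positivity)]
  unfold edKernelXY edKernelX edKernelY segAverage
  linear_combination Real.pi⁻¹ * hint

end RiemannKernel

section Superposition

/-- Superposition `∫₀ˣ f(s) Ψ(x, y, s) ds`. -/
def superpose (f : ℝ → ℝ) (Ψ : ℝ → ℝ → ℝ → ℝ) (x y : ℝ) : ℝ := ∫ s in (0 : ℝ)..x, f s * Ψ x y s

variable {f : ℝ → ℝ} {Ψ Ψ' : ℝ → ℝ → ℝ → ℝ} {x y : ℝ}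

lemma exists_splitting (hx : x < 1) (hy : y < 1) (hxy : x + y < 1) :
    ∃ c, 0 < c ∧ c < 1 ∧ x < c ∧ y < 1 - c := by
  obtain ⟨c, h1, h2⟩ := exists_between (show max x 0 < min 1 (1 - y) from
    max_lt (lt_min hx (by linarith)) (lt_min one_pos (by linarith)))
  rw [max_lt_iff] at h1
  rw [lt_min_iff] at h2
  exact ⟨c, h1.2, h2.1, h1.1, by linarith⟩

lemma mem_kernelDomain_of_splitting {c s : ℝ} (hc : c < 1) (hx : x < c) (hy : y < 1 - c)
    (hs : s < c) : ((x, y), s) ∈ kernelDomain :=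
  ⟨⟨hx.trans hc, hs.trans hc⟩, by dsimp only; linarith, by dsimp only; linarith⟩

lemma continuousAt_superpose (hf : ∀ c < 1, IntervalIntegrable f volume (-1) c)
    (hΨ : ContinuousOn (fun q : (ℝ × ℝ) × ℝ => Ψ q.1.1 q.1.2 q.2) kernelDomain)
    (hx' : -1 < x) (hx : x < 1) (hy : y < 1) (hxy : x + y < 1) :
    ContinuousAt (fun p : ℝ × ℝ => superpose f Ψ p.1 p.2) (x, y) := by
  obtain ⟨c, hc0, hc1, hxc, hyc⟩ := exists_splitting hx hy hxy
  have h := continuousAt_parametric_primitive (U := Iio c ×ˢ Iio (1 - c)) (b := c) (f := f)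
    (Ψ := fun q : (ℝ × ℝ) × ℝ => Ψ q.1.1 q.1.2 q.2) (isOpen_Iio.prod isOpen_Iio) hc0
    (fun d hd => hf d (hd.trans hc1))
    (hΨ.mono fun q hq => mem_kernelDomain_of_splitting hc1 hq.1.1 hq.1.2 hq.2)
    (p₀ := (x, y)) (mk_mem_prod hxc hyc) (a₀ := x) ⟨hx', hxc⟩
  exact ContinuousAt.comp (f := fun p : ℝ × ℝ => (p, p.1)) h (by fun_prop)

lemma contDiffAt_superpose (hf : ∀ c < 1, IntervalIntegrable f volume (-1) c)
    {k : ℕ} (hfk : ContDiffOn ℝ k f (Ioo 0 1))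
    (hΨ : ∀ m : ℕ, ContDiffOn ℝ m (fun q : (ℝ × ℝ) × ℝ => Ψ q.1.1 q.1.2 q.2) kernelDomain)
    (hx' : 0 < x) (hx : x < 1) (hy : y < 1) (hxy : x + y < 1) :
    ContDiffAt ℝ (k + 1 : ℕ) (fun p : ℝ × ℝ => superpose f Ψ p.1 p.2) (x, y) := by
  obtain ⟨c, hc0, hc1, hxc, hyc⟩ := exists_splitting hx hy hxy
  have hU : IsOpen (Iio c ×ˢ Iio (1 - c)) := isOpen_Iio.prod isOpen_Iio
  have h := contDiffOn_parametric_primitive (b := c) (f := f) (k := k) (j := k + 1)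
    (Ψ := fun q : (ℝ × ℝ) × ℝ => Ψ q.1.1 q.1.2 q.2) hU hc0
    (fun d hd => hf d (hd.trans hc1)) (hfk.mono (Ioo_subset_Ioo_right hc1.le))
    (fun m => (hΨ m).mono fun q hq => mem_kernelDomain_of_splitting hc1 hq.1.1 hq.1.2 hq.2) le_rfl
  have hmem : ((x, y), x) ∈ (Iio c ×ˢ Iio (1 - c)) ×ˢ Ioo 0 c := ⟨⟨hxc, hyc⟩, hx', hxc⟩
  have h' := h.contDiffAt ((hU.prod isOpen_Ioo).mem_nhds hmem)
  exact ContDiffAt.comp (f := fun p : ℝ × ℝ => (p, p.1)) (x, y) h' (by fun_prop)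

lemma hasDerivAt_superpose_left (hf : ∀ c < 1, IntervalIntegrable f volume (-1) c)
    (hfc : ContinuousOn f (Ioo 0 1))
    (hΨ : ContinuousOn (fun q : (ℝ × ℝ) × ℝ => Ψ q.1.1 q.1.2 q.2) kernelDomain)
    (hΨ' : ContinuousOn (fun q : (ℝ × ℝ) × ℝ => Ψ' q.1.1 q.1.2 q.2) kernelDomain)
    (hd : ∀ {x y s}, ((x, y), s) ∈ kernelDomain → HasDerivAt (fun x => Ψ x y s) (Ψ' x y s) x)
    (hx' : 0 < x) (hx : x < 1) (hy : y < 1) (hxy : x + y < 1) :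
    HasDerivAt (fun x => superpose f Ψ x y) (superpose f Ψ' x y + f x * Ψ x y x) x := by
  obtain ⟨c, hc0, hc1, hxc, hyc⟩ := exists_splitting hx hy hxy
  have hmaps : MapsTo (fun q : ℝ × ℝ => ((q.1, y), q.2)) (Iio c ×ˢ Iio c) kernelDomain :=
    fun q hq => mem_kernelDomain_of_splitting hc1 hq.1 hyc hq.2
  exact hasDerivAt_parametric_primitive_diag (U := Iio c) (b := c)
    (Ψ := fun q => Ψ q.1 y q.2) (Ψ' := fun q => Ψ' q.1 y q.2) isOpen_Iio hc0
    (fun d hd => hf d (hd.trans hc1)) (hfc.mono (Ioo_subset_Ioo_right hc1.le))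
    (hΨ.comp (by fun_prop) hmaps) (hΨ'.comp (by fun_prop) hmaps)
    (fun p hp s hs => hd (mem_kernelDomain_of_splitting hc1 hp hyc hs)) hxc ⟨hx', hxc⟩

lemma hasDerivAt_superpose_right (hf : ∀ c < 1, IntervalIntegrable f volume (-1) c)
    (hΨ : ContinuousOn (fun q : (ℝ × ℝ) × ℝ => Ψ q.1.1 q.1.2 q.2) kernelDomain)
    (hΨ' : ContinuousOn (fun q : (ℝ × ℝ) × ℝ => Ψ' q.1.1 q.1.2 q.2) kernelDomain)
    (hd : ∀ {x y s}, ((x, y), s) ∈ kernelDomain → HasDerivAt (fun y => Ψ x y s) (Ψ' x y s) y)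
    (hx' : -1 < x) (hx : x < 1) (hy : y < 1) (hxy : x + y < 1) :
    HasDerivAt (fun y => superpose f Ψ x y) (superpose f Ψ' x y) y := by
  obtain ⟨c, hc0, hc1, hxc, hyc⟩ := exists_splitting hx hy hxy
  have hmaps : MapsTo (fun q : ℝ × ℝ => ((x, q.1), q.2)) (Iio (1 - c) ×ˢ Iio c) kernelDomain :=
    fun q hq => mem_kernelDomain_of_splitting hc1 hxc hq.1 hq.2
  exact hasDerivAt_parametric_integral (U := Iio (1 - c)) (b := c)
    (Ψ := fun q => Ψ x q.1 q.2) (Ψ' := fun q => Ψ' x q.1 q.2) isOpen_Iio hc0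
    (fun d hd => hf d (hd.trans hc1)) (hΨ.comp (by fun_prop) hmaps) (hΨ'.comp (by fun_prop) hmaps)
    (fun p hp s hs => hd (mem_kernelDomain_of_splitting hc1 hxc hp hs)) hyc ⟨hx', hxc⟩

lemma intervalIntegrable_superpose (hf : ∀ c < 1, IntervalIntegrable f volume (-1) c)
    (hΨ : ContinuousOn (fun q : (ℝ × ℝ) × ℝ => Ψ q.1.1 q.1.2 q.2) kernelDomain)
    (hx : x < 1) (hy : y < 1) (hxy : x + y < 1) :
    IntervalIntegrable (fun s => f s * Ψ x y s) volume 0 x := by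
  obtain ⟨c, hc0, hc1, hxc, hyc⟩ := exists_splitting hx hy hxy
  exact intervalIntegrable_smul_slice (U := Iio c ×ˢ Iio (1 - c)) (b := c)
    (Ψ := fun q : (ℝ × ℝ) × ℝ => Ψ q.1.1 q.1.2 q.2) (fun d hd => hf d (hd.trans hc1))
    (hΨ.mono fun q hq => mem_kernelDomain_of_splitting hc1 hq.1.1 hq.1.2 hq.2)
    (p := (x, y)) (mk_mem_prod hxc hyc) hc0 hxc

end Superposition

section HalfSolution

variable {f : ℝ → ℝ} {x y : ℝ}

/-- The Euler–Darboux solution whose trace on `y = 0` is the primitive of `f` and which vanishes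
on `x = 0`. -/
def edHalf (f : ℝ → ℝ) : ℝ → ℝ → ℝ := superpose f edKernel

/-- The derivative of `edHalf` in `x`. -/
def edHalfX (f : ℝ → ℝ) (x y : ℝ) : ℝ := superpose f edKernelX x y + f x * edKernel x y x

/-- The derivative of `edHalf` in `y`. -/
def edHalfY (f : ℝ → ℝ) : ℝ → ℝ → ℝ := superpose f edKernelY

/-- The mixed derivative of `edHalf`. -/
def edHalfXY (f : ℝ → ℝ) (x y : ℝ) : ℝ := superpose f edKernelXY x y + f x * edKernelY x y x

lemma hasDerivAt_edHalf_left (hf : ∀ c < 1, IntervalIntegrable f volume (-1) c)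
    (hfc : ContinuousOn f (Ioo 0 1)) (hx : 0 < x) (hy : 0 < y) (hxy : x + y < 1) :
    HasDerivAt (fun x => edHalf f x y) (edHalfX f x y) x :=
  hasDerivAt_superpose_left hf hfc (contDiffOn_edKernel 0).continuousOn continuousOn_edKernelX
    hasDerivAt_edKernel_left hx (by linarith) (by linarith) hxy

lemma hasDerivAt_edHalfY_left (hf : ∀ c < 1, IntervalIntegrable f volume (-1) c)
    (hfc : ContinuousOn f (Ioo 0 1)) (hx : 0 < x) (hy : 0 < y) (hxy : x + y < 1) :
    HasDerivAt (fun x => edHalfY f x y) (edHalfXY f x y) x :=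
  hasDerivAt_superpose_left hf hfc continuousOn_edKernelY continuousOn_edKernelXY
    hasDerivAt_edKernelY_left hx (by linarith) (by linarith) hxy

lemma hasDerivAt_edHalf_right (hf : ∀ c < 1, IntervalIntegrable f volume (-1) c)
    (hx : 0 < x) (hy : 0 < y) (hxy : x + y < 1) :
    HasDerivAt (fun y => edHalf f x y) (edHalfY f x y) y :=
  hasDerivAt_superpose_right hf (contDiffOn_edKernel 0).continuousOn continuousOn_edKernelY
    hasDerivAt_edKernel_right (by linarith) (by linarith) (by linarith) hxy

lemma hasDerivAt_edHalfX_right (hf : ∀ c < 1, IntervalIntegrable f volume (-1) c)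
    (hx : 0 < x) (hy : 0 < y) (hxy : x + y < 1) :
    HasDerivAt (fun y => edHalfX f x y) (edHalfXY f x y) y :=
  (hasDerivAt_superpose_right hf continuousOn_edKernelX continuousOn_edKernelXY
    hasDerivAt_edKernelX_right (by linarith) (by linarith) (by linarith) hxy).add
    ((hasDerivAt_edKernel_right ⟨⟨by dsimp only; linarith, by dsimp only; linarith⟩,
      hxy, hxy⟩).const_mul (f x))

lemma edHalf_eulerDarboux (hf : ∀ c < 1, IntervalIntegrable f volume (-1) c)
    (hx : 0 < x) (hy : 0 < y) (hxy : x + y < 1) :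
    edHalfXY f x y = (edHalfX f x y + edHalfY f x y) / (2 * (1 - x - y)) := by
  have hX := intervalIntegrable_superpose (x := x) (y := y) hf continuousOn_edKernelX
    (by linarith) (by linarith) hxy
  have hY := intervalIntegrable_superpose (x := x) (y := y) hf continuousOn_edKernelY
    (by linarith) (by linarith) hxy
  have h : superpose f edKernelXY x y
      = (superpose f edKernelX x y + superpose f edKernelY x y) / (2 * (1 - x - y)) := by
    unfold superpose
    rw [← intervalIntegral.integral_add hX hY, ← intervalIntegral.integral_div]
    refine intervalIntegral.integral_congr fun s hs => ?_
    rw [uIcc_of_le hx.le] at hs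
    have hq : ((x, y), s) ∈ kernelDomain :=
      ⟨⟨by dsimp only; linarith, by dsimp only; linarith [hs.2]⟩, hxy,
        by dsimp only; linarith [hs.2]⟩
    simp only [edKernel_eulerDarboux hq]
    ring
  rw [edHalfXY, edHalfX, edHalfY, h, edKernelY_diag]
  ring

lemma continuousOn_superpose_triD {Ψ : ℝ → ℝ → ℝ → ℝ}
    (hf : ∀ c < 1, IntervalIntegrable f volume (-1) c)
    (hΨ : ContinuousOn (fun q : (ℝ × ℝ) × ℝ => Ψ q.1.1 q.1.2 q.2) kernelDomain) :
    ContinuousOn (fun p : ℝ × ℝ => superpose f Ψ p.1 p.2) TriD := by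
  rintro ⟨x, y⟩ ⟨h1, h2, h3⟩
  dsimp only at h1 h2 h3
  exact (continuousAt_superpose hf hΨ (by linarith) (by linarith) (by linarith)
    h3).continuousWithinAt

lemma continuousOn_edHalf (hf : ∀ c < 1, IntervalIntegrable f volume (-1) c) :
    ContinuousOn (fun p : ℝ × ℝ => edHalf f p.1 p.2) TriD :=
  continuousOn_superpose_triD hf (contDiffOn_edKernel 0).continuousOn

lemma continuousOn_edHalfY (hf : ∀ c < 1, IntervalIntegrable f volume (-1) c) :
    ContinuousOn (fun p : ℝ × ℝ => edHalfY f p.1 p.2) TriD :=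
  continuousOn_superpose_triD hf continuousOn_edKernelY

lemma edHalf_zero_left (f : ℝ → ℝ) (y : ℝ) : edHalf f 0 y = 0 := by simp [edHalf, superpose]

lemma edHalf_zero_right (f : ℝ → ℝ) (hx : x ∈ Ico 0 1) :
    edHalf f x 0 = ∫ s in (0 : ℝ)..x, f s := by
  refine intervalIntegral.integral_congr fun s hs => ?_
  rw [uIcc_of_le hx.1] at hs
  simp [edKernel_zero_right hx.2 (hs.2.trans_lt hx.2)]

end HalfSolution

section Data

lemma mem_interior_triD_s2 {p : ℝ × ℝ} :
    p ∈ interior TriD ↔ 0 < p.1 ∧ 0 < p.2 ∧ p.1 + p.2 < 1 := by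
  constructor
  · intro hp
    have hsub : TriD ⊆ Ici (0 : ℝ) ×ˢ Ici (0 : ℝ) := fun q hq => mk_mem_prod hq.1 hq.2.1
    have h1 := interior_mono hsub hp
    rw [interior_prod_eq, interior_Ici] at h1
    exact ⟨h1.1, h1.2, (interior_subset hp).2.2⟩
  · have hopen : IsOpen {p : ℝ × ℝ | 0 < p.1 ∧ 0 < p.2 ∧ p.1 + p.2 < 1} := by
      simp only [ofPred_and]
      exact (isOpen_lt (by fun_prop) (by fun_prop)).inter
        ((isOpen_lt (by fun_prop) (by fun_prop)).inter (isOpen_lt (by fun_prop) (by fun_prop)))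
    have hsub : {p : ℝ × ℝ | 0 < p.1 ∧ 0 < p.2 ∧ p.1 + p.2 < 1} ⊆ TriD :=
      fun q hq => ⟨hq.1.le, hq.2.1.le, hq.2.2⟩
    exact fun hp => interior_maximal hsub hopen hp

/-- What the superposition formula needs to know about the derivative of a boundary datum. -/
lemma EDData.exists_density {n : ℕ} (hn : 1 ≤ n) {α : ℝ} (hα : α ∈ Ico (0 : ℝ) 1) {V₀ : ℝ → ℝ}
    (h : EDData n α V₀) : ∃ f g : ℝ → ℝ, (∀ c < 1, IntervalIntegrable f volume (-1) c) ∧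
      ContDiffOn ℝ (n - 1 : ℕ) f (Ioo 0 1) ∧ ContinuousOn g (Ico 0 1) ∧
      (∀ x ∈ Ioo (0 : ℝ) 1, g x = x ^ α * f x) ∧
      ∀ x ∈ Ico (0 : ℝ) 1, ∫ s in (0 : ℝ)..x, f s = V₀ x := by
  obtain ⟨hcont, hdiff, ⟨g, hg, hgf⟩, hV0⟩ := h
  have hind : ∀ {s}, 0 < s → (Ioi 0).indicator (deriv V₀) s = deriv V₀ s := fun hs =>
    indicator_of_mem (mem_Ioi.2 hs) _
  have hneg : IntervalIntegrable ((Ioi 0).indicator (deriv V₀)) volume (-1) 0 := by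
    refine (intervalIntegrable_const (c := (0 : ℝ))).congr ?_
    intro s hs
    rw [uIoc_of_le (by norm_num)] at hs
    exact (indicator_of_notMem (not_lt.2 hs.2) _).symm
  have hpos : ∀ c ∈ Ico (0 : ℝ) 1,
      IntervalIntegrable ((Ioi 0).indicator (deriv V₀)) volume 0 c := by
    intro c hc
    have h1 : IntervalIntegrable (fun s : ℝ => s ^ (-α) * g s) volume 0 c := by
      refine (intervalIntegral.intervalIntegrable_rpow' (by linarith [hα.2])).mul_continuousOn
        (hg.mono ?_)
      rw [uIcc_of_le hc.1]
      exact fun s hs => ⟨hs.1, hs.2.trans_lt hc.2⟩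
    refine h1.congr ?_
    intro s hs
    rw [uIoc_of_le hc.1] at hs
    simp only [hind hs.1, hgf s ⟨hs.1, hs.2.trans_lt hc.2⟩]
    rw [← mul_assoc, ← Real.rpow_add hs.1]
    simp
  refine ⟨(Ioi 0).indicator (deriv V₀), g, ?_, ?_, hg, fun x hx => by rw [hgf x hx, hind hx.1], ?_⟩
  · intro c hc
    rcases le_total 0 c with h0 | h0
    · exact hneg.trans (hpos c ⟨h0, hc⟩)
    · refine (intervalIntegrable_const (c := (0 : ℝ))).congr ?_
      intro s hs
      have : s ≤ 0 := hs.2.trans (max_le (by norm_num) h0)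
      exact (indicator_of_notMem (not_lt.2 this) _).symm
  · refine ContDiffOn.congr (f := deriv V₀) ?_ fun x hx => hind hx.1
    refine hdiff.deriv_of_isOpen isOpen_Ioo ?_
    exact_mod_cast (by omega : n - 1 + 1 ≤ n)
  · intro x hx
    have := intervalIntegral.integral_eq_sub_of_hasDerivAt_of_le hx.1
      (hcont.mono fun s hs => ⟨hs.1, hs.2.trans_lt hx.2⟩) (f' := (Ioi 0).indicator (deriv V₀))
      (fun s hs => ?_) (hpos x hx)
    · rw [this, hV0, sub_zero]
    · rw [hind hs.1]
      exact ((hdiff.differentiableOn (by exact_mod_cast (by omega : n ≠ 0))).differentiableAt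
        (isOpen_Ioo.mem_nhds ⟨hs.1, hs.2.trans hx.2⟩)).hasDerivAt

lemma ErnstData.neg_log {n : ℕ} (hn : 1 ≤ n) {α : ℝ} {E₀ : ℝ → ℝ}
    (h : ErnstData n α fun x => (E₀ x : ℂ)) : EDData n α fun x => -Real.log (E₀ x) := by
  obtain ⟨hcont, hdiff, ⟨g, hg, hgf⟩, h0, hpos⟩ := h
  simp only [ofReal_re] at hpos
  have hcont' : ContinuousOn E₀ (Ico 0 1) := by
    simpa [Function.comp_def] using continuous_re.comp_continuousOn hcont
  have hdiff' : ContDiffOn ℝ n E₀ (Ioo 0 1) := by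
    simpa [Function.comp_def] using reCLM.contDiff.comp_contDiffOn hdiff
  have hsub : Ioo (0 : ℝ) 1 ⊆ Ico 0 1 := Ioo_subset_Ico_self
  refine ⟨(hcont'.log fun x hx => (hpos x hx).ne').neg,
    (hdiff'.log fun x hx => (hpos x (hsub hx)).ne').neg,
    ⟨fun x => -((g x).re / E₀ x), ?_, fun x hx => ?_⟩, ?_⟩
  · exact ((continuous_re.comp_continuousOn hg).div hcont' fun x hx => (hpos x hx).ne').neg
  · have hE : HasDerivAt E₀ (deriv E₀ x) x :=
      ((hdiff'.differentiableOn (by exact_mod_cast (by omega : n ≠ 0))).differentiableAt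
        (isOpen_Ioo.mem_nhds hx)).hasDerivAt
    beta_reduce
    rw [hgf x hx, hE.ofReal_comp.deriv, deriv.fun_neg, (hE.log (hpos x (hsub hx)).ne').deriv,
      ← ofReal_mul, ofReal_re]
    ring
  · have h0' : (E₀ 0 : ℂ) = 1 := h0
    have : E₀ 0 = 1 := by exact_mod_cast h0'
    simp [this]

end Data

section Assembly

/-- `V`, with partial derivatives `Vx`, `Vy` and mixed derivative `Vxy` in the open triangle. -/
structure HasTrianglePartials (V Vx Vy Vxy : ℝ → ℝ → ℝ) : Prop where
  left : ∀ p ∈ interior TriD, HasDerivAt (fun t => V t p.2) (Vx p.1 p.2) p.1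
  right : ∀ p ∈ interior TriD, HasDerivAt (fun t => V p.1 t) (Vy p.1 p.2) p.2
  mixed : ∀ p ∈ interior TriD, HasDerivAt (fun t => Vy t p.2) (Vxy p.1 p.2) p.1

lemma eventually_mem_interior_triD {p : ℝ × ℝ} (hp : p ∈ interior TriD) :
    ∀ᶠ t in 𝓝 p.1, (t, p.2) ∈ interior TriD :=
  (Continuous.continuousAt (f := fun t : ℝ => (t, p.2)) (by fun_prop)).eventually_mem
    (isOpen_interior.mem_nhds hp)

variable {V Vx Vy Vxy : ℝ → ℝ → ℝ}

lemma HasTrianglePartials.pdxyR_eq (h : HasTrianglePartials V Vx Vy Vxy) {p : ℝ × ℝ}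
    (hp : p ∈ interior TriD) : pdxyR V p.1 p.2 = Vxy p.1 p.2 := by
  refine ((h.mixed p hp).congr_of_eventuallyEq ?_).deriv
  filter_upwards [eventually_mem_interior_triD hp] with t ht using (h.right _ ht).deriv

lemma exp_neg_pdx (h : HasTrianglePartials V Vx Vy Vxy) {p : ℝ × ℝ} (hp : p ∈ interior TriD) :
    pdx (fun x y => ((Real.exp (-(V x y)) : ℝ) : ℂ)) p.1 p.2
      = ((-(Vx p.1 p.2) * Real.exp (-(V p.1 p.2)) : ℝ) : ℂ) := by
  rw [mul_comm]
  exact (h.left p hp).neg.exp.ofReal_comp.deriv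

lemma exp_neg_pdy (h : HasTrianglePartials V Vx Vy Vxy) {p : ℝ × ℝ} (hp : p ∈ interior TriD) :
    pdy (fun x y => ((Real.exp (-(V x y)) : ℝ) : ℂ)) p.1 p.2
      = ((-(Vy p.1 p.2) * Real.exp (-(V p.1 p.2)) : ℝ) : ℂ) := by
  rw [mul_comm]
  exact (h.right p hp).neg.exp.ofReal_comp.deriv

lemma exp_neg_pdxy (h : HasTrianglePartials V Vx Vy Vxy) {p : ℝ × ℝ} (hp : p ∈ interior TriD) :
    pdxy (fun x y => ((Real.exp (-(V x y)) : ℝ) : ℂ)) p.1 p.2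
      = (((Vx p.1 p.2 * Vy p.1 p.2 - Vxy p.1 p.2) * Real.exp (-(V p.1 p.2)) : ℝ) : ℂ) := by
  have h1 := ((h.mixed p hp).neg.mul (h.left p hp).neg.exp).ofReal_comp
  refine ((h1.congr_of_eventuallyEq ?_).deriv).trans ?_
  · filter_upwards [eventually_mem_interior_triD hp] with t ht using exp_neg_pdy h ht
  · congr 1
    simp only [Pi.neg_apply]
    ring

lemma ErnstSolutionWith.of_eulerDarboux {n : ℕ} {α : ℝ} {E₀ E₁ : ℝ → ℝ}
    (hpos₀ : ∀ x ∈ Ico (0 : ℝ) 1, 0 < E₀ x) (hpos₁ : ∀ y ∈ Ico (0 : ℝ) 1, 0 < E₁ y)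
    (h : HasTrianglePartials V Vx Vy Vxy)
    (hV : EDSolutionWith n α V (fun x => -Real.log (E₀ x)) (fun y => -Real.log (E₁ y))) :
    ErnstSolutionWith n α (fun x y => ((Real.exp (-(V x y)) : ℝ) : ℂ))
      (fun x => (E₀ x : ℂ)) (fun y => (E₁ y : ℂ)) := by
  obtain ⟨hc, hn, heq, ⟨gx, hgx, hgx'⟩, ⟨gy, hgy, hgy'⟩, ⟨gxy, hgxy, hgxy'⟩, h0, h1⟩ := hV
  have hpx : ∀ p ∈ interior TriD, pdxR V p.1 p.2 = Vx p.1 p.2 := fun p hp => (h.left p hp).deriv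
  have hpy : ∀ p ∈ interior TriD, pdyR V p.1 p.2 = Vy p.1 p.2 := fun p hp => (h.right p hp).deriv
  have hexp : ContinuousOn (fun p : ℝ × ℝ => Real.exp (-(V p.1 p.2))) TriD := hc.neg.rexp
  refine ⟨continuous_ofReal.comp_continuousOn hexp,
    ofRealCLM.contDiff.comp_contDiffOn hn.neg.exp, fun p hp => ?_,
    ⟨fun p => ((-(gx p) * Real.exp (-(V p.1 p.2)) : ℝ) : ℂ), ?_, fun p hp => ?_⟩,
    ⟨fun p => ((-(gy p) * Real.exp (-(V p.1 p.2)) : ℝ) : ℂ), ?_, fun p hp => ?_⟩,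
    ⟨fun p => (((gx p * gy p - gxy p) * Real.exp (-(V p.1 p.2)) : ℝ) : ℂ), ?_, fun p hp => ?_⟩,
    fun x hx => ?_, fun y hy => ?_, fun p hp => ?_⟩
  · have hE := heq p hp
    rw [EulerDarbouxAt, h.pdxyR_eq hp, hpx p hp, hpy p hp, sub_eq_zero] at hE
    rw [ErnstEqAt, exp_neg_pdx h hp, exp_neg_pdy h hp, exp_neg_pdxy h hp, hE]
    rw [ofReal_re]
    push_cast
    ring
  · exact continuous_ofReal.comp_continuousOn (hgx.neg.mul hexp)
  · beta_reduce
    rw [exp_neg_pdx h hp, hgx' p hp, hpx p hp, ← ofReal_mul]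
    congr 1; ring
  · exact continuous_ofReal.comp_continuousOn (hgy.neg.mul hexp)
  · beta_reduce
    rw [exp_neg_pdy h hp, hgy' p hp, hpy p hp, ← ofReal_mul]
    congr 1; ring
  · exact continuous_ofReal.comp_continuousOn (((hgx.mul hgy).sub hgxy).mul hexp)
  · beta_reduce
    rw [exp_neg_pdxy h hp, hgx' p hp, hpx p hp, hgy' p hp, hpy p hp, hgxy' p hp, h.pdxyR_eq hp,
      ← ofReal_mul]
    congr 1; ring
  · dsimp only
    rw [h0 x hx, neg_neg, Real.exp_log (hpos₀ x hx)]
  · dsimp only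
    rw [h1 y hy, neg_neg, Real.exp_log (hpos₁ y hy)]
  · rw [ofReal_re]; exact Real.exp_pos _

lemma continuousOn_triD_swap {F : ℝ → ℝ → ℝ}
    (hF : ContinuousOn (fun p : ℝ × ℝ => F p.1 p.2) TriD) :
    ContinuousOn (fun p : ℝ × ℝ => F p.2 p.1) TriD :=
  hF.comp continuous_swap.continuousOn fun p hp =>
    ⟨hp.2.1, hp.1, by simpa [add_comm] using hp.2.2⟩

lemma contDiffOn_triD_swap {n : ℕ} {F : ℝ → ℝ → ℝ}
    (hF : ContDiffOn ℝ n (fun p : ℝ × ℝ => F p.1 p.2) (interior TriD)) :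
    ContDiffOn ℝ n (fun p : ℝ × ℝ => F p.2 p.1) (interior TriD) :=
  hF.comp (f := fun p : ℝ × ℝ => (p.2, p.1)) (contDiff_snd.prodMk contDiff_fst).contDiffOn
    fun p hp => by
      rw [mem_interior_triD_s2] at hp
      exact mem_interior_triD_s2.2 ⟨hp.2.1, hp.1, by linarith [hp.2.2]⟩

lemma continuousOn_triD_profile : ContinuousOn (fun p : ℝ × ℝ => profile p.1 p.2) TriD :=
  (contDiffOn_profile 0).continuousOn.mono fun p hp =>
    ⟨by linarith [hp.2.1, hp.2.2], hp.2.2⟩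

lemma exists_continuousOn_weighted_left {α : ℝ} (hα : 0 ≤ α) {f g f₁ : ℝ → ℝ}
    (hf : ∀ c < 1, IntervalIntegrable f volume (-1) c)
    (hf₁ : ∀ c < 1, IntervalIntegrable f₁ volume (-1) c) (hg : ContinuousOn g (Ico 0 1))
    (hgf : ∀ x ∈ Ioo (0 : ℝ) 1, g x = x ^ α * f x) :
    ∃ G : ℝ → ℝ → ℝ, ContinuousOn (fun p : ℝ × ℝ => G p.1 p.2) TriD ∧
      ∀ x y, 0 < x → 0 < y → x + y < 1 →
        G x y = x ^ α * (edHalfX f x y + edHalfY f₁ y x) := by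
  have hpow : ContinuousOn (fun p : ℝ × ℝ => p.1 ^ α) TriD :=
    continuousOn_fst.rpow_const fun _ _ => Or.inr hα
  refine ⟨fun x y => x ^ α * (superpose f edKernelX x y + edHalfY f₁ y x) + g x * profile x y,
    ?_, fun x y hx hy hxy => ?_⟩
  · exact (hpow.mul ((continuousOn_superpose_triD hf continuousOn_edKernelX).add
      (continuousOn_triD_swap (continuousOn_edHalfY hf₁)))).add
      ((hg.comp continuousOn_fst fun p hp => ⟨hp.1, by linarith [hp.2.1, hp.2.2]⟩).mul
        continuousOn_triD_profile)
  · simp only [edHalfX, edKernel_diag, hgf x ⟨hx, by linarith⟩]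
    ring

lemma contDiffOn_edHalf {n : ℕ} (hn : 1 ≤ n) {f : ℝ → ℝ}
    (hf : ∀ c < 1, IntervalIntegrable f volume (-1) c)
    (hfd : ContDiffOn ℝ (n - 1 : ℕ) f (Ioo 0 1)) :
    ContDiffOn ℝ n (fun p : ℝ × ℝ => edHalf f p.1 p.2) (interior TriD) := by
  intro p hp
  obtain ⟨hx, hy, hxy⟩ := mem_interior_triD_s2.1 hp
  have h := contDiffAt_superpose (x := p.1) (y := p.2) hf hfd contDiffOn_edKernel hx
    (by linarith) (by linarith) hxy
  rw [Nat.sub_add_cancel hn] at h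
  exact h.contDiffWithinAt

/-- Solvability of the Euler–Darboux Goursat problem. -/
lemma exists_edSolutionWith {n : ℕ} (hn : 1 ≤ n) {α : ℝ} (hα : α ∈ Ico (0 : ℝ) 1) {V₀ V₁ : ℝ → ℝ}
    (h₀ : EDData n α V₀) (h₁ : EDData n α V₁) :
    ∃ V Vx Vy Vxy, HasTrianglePartials V Vx Vy Vxy ∧ EDSolutionWith n α V V₀ V₁ := by
  obtain ⟨f₀, g₀, hf₀, hd₀, hg₀, hgf₀, hV₀⟩ := h₀.exists_density hn hα
  obtain ⟨f₁, g₁, hf₁, hd₁, hg₁, hgf₁, hV₁⟩ := h₁.exists_density hn hα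
  have hc₀ := hd₀.continuousOn
  have hc₁ := hd₁.continuousOn
  have hP : HasTrianglePartials (fun x y => edHalf f₀ x y + edHalf f₁ y x)
      (fun x y => edHalfX f₀ x y + edHalfY f₁ y x) (fun x y => edHalfY f₀ x y + edHalfX f₁ y x)
      (fun x y => edHalfXY f₀ x y + edHalfXY f₁ y x) := by
    refine ⟨fun p hp => ?_, fun p hp => ?_, fun p hp => ?_⟩ <;>
      obtain ⟨hx, hy, hxy⟩ := mem_interior_triD_s2.1 hp <;>
      have hyx : p.2 + p.1 < 1 := by rwa [add_comm]
    · exact (hasDerivAt_edHalf_left hf₀ hc₀ hx hy hxy).add (hasDerivAt_edHalf_right hf₁ hy hx hyx)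
    · exact (hasDerivAt_edHalf_right hf₀ hx hy hxy).add
        (hasDerivAt_edHalf_left hf₁ hc₁ hy hx hyx)
    · exact (hasDerivAt_edHalfY_left hf₀ hc₀ hx hy hxy).add
        (hasDerivAt_edHalfX_right hf₁ hy hx hyx)
  have hED : ∀ p ∈ interior TriD, edHalfXY f₀ p.1 p.2 + edHalfXY f₁ p.2 p.1
      = (edHalfX f₀ p.1 p.2 + edHalfY f₁ p.2 p.1 + (edHalfY f₀ p.1 p.2 + edHalfX f₁ p.2 p.1))
        / (2 * (1 - p.1 - p.2)) := by
    intro p hp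
    obtain ⟨hx, hy, hxy⟩ := mem_interior_triD_s2.1 hp
    rw [edHalf_eulerDarboux hf₀ hx hy hxy, edHalf_eulerDarboux hf₁ hy hx (by rwa [add_comm]),
      sub_right_comm 1 p.2 p.1]
    ring
  have hpowx : ContinuousOn (fun p : ℝ × ℝ => p.1 ^ α) TriD :=
    continuousOn_fst.rpow_const fun _ _ => Or.inr hα.1
  have hpowy : ContinuousOn (fun p : ℝ × ℝ => p.2 ^ α) TriD :=
    continuousOn_snd.rpow_const fun _ _ => Or.inr hα.1
  obtain ⟨G₀, hG₀, hG₀'⟩ := exists_continuousOn_weighted_left hα.1 hf₀ hf₁ hg₀ hgf₀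
  obtain ⟨G₁, hG₁, hG₁'⟩ := exists_continuousOn_weighted_left hα.1 hf₁ hf₀ hg₁ hgf₁
  replace hG₁ := continuousOn_triD_swap hG₁
  have hpx : ∀ p ∈ interior TriD, pdxR (fun x y => edHalf f₀ x y + edHalf f₁ y x) p.1 p.2
      = edHalfX f₀ p.1 p.2 + edHalfY f₁ p.2 p.1 := fun p hp => (hP.left p hp).deriv
  have hpy : ∀ p ∈ interior TriD, pdyR (fun x y => edHalf f₀ x y + edHalf f₁ y x) p.1 p.2
      = edHalfY f₀ p.1 p.2 + edHalfX f₁ p.2 p.1 := fun p hp => (hP.right p hp).deriv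
  refine ⟨_, _, _, _, hP, ?_, ?_, fun p hp => ?_, ⟨_, hG₀, fun p hp => ?_⟩,
    ⟨_, hG₁, fun p hp => ?_⟩,
    ⟨fun p => (p.2 ^ α * G₀ p.1 p.2 + p.1 ^ α * G₁ p.2 p.1) / (2 * (1 - p.1 - p.2)),
      ?_, fun p hp => ?_⟩, fun x hx => ?_, fun y hy => ?_⟩
  · exact (continuousOn_edHalf hf₀).add (continuousOn_triD_swap (continuousOn_edHalf hf₁))
  · exact (contDiffOn_edHalf hn hf₀ hd₀).add
      (contDiffOn_triD_swap (contDiffOn_edHalf hn hf₁ hd₁))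
  · rw [EulerDarbouxAt, hP.pdxyR_eq hp, hpx p hp, hpy p hp, hED p hp, sub_self]
  · obtain ⟨hx, hy, hxy⟩ := mem_interior_triD_s2.1 hp
    rw [hpx p hp]
    exact hG₀' _ _ hx hy hxy
  · obtain ⟨hx, hy, hxy⟩ := mem_interior_triD_s2.1 hp
    rw [hpy p hp, add_comm]
    exact hG₁' _ _ hy hx (by rwa [add_comm])
  · refine ((hpowy.mul hG₀).add (hpowx.mul hG₁)).div (by fun_prop) fun p hp => ?_
    have := hp.2.2
    exact (by linarith : 0 < 2 * (1 - p.1 - p.2)).ne'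
  · obtain ⟨hx, hy, hxy⟩ := mem_interior_triD_s2.1 hp
    beta_reduce
    rw [hP.pdxyR_eq hp, hED p hp, hG₀' _ _ hx hy hxy, hG₁' _ _ hy hx (by rwa [add_comm])]
    ring
  · dsimp only
    rw [edHalf_zero_left, edHalf_zero_right f₀ hx, hV₀ x hx, add_zero]
  · dsimp only
    rw [edHalf_zero_left, edHalf_zero_right f₁ hy, hV₁ y hy, zero_add]

end Assembly

/-- Existence for collinearly polarized (real, strictly positive) data:
the solution is given by ℰ = e^{-V} where V solves the Euler–Darboux Goursat problem
with data {-log ℰ0, -log ℰ1}. -/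
theorem ernst_goursat_existence_collinear
    (n : ℕ) (hn : 2 ≤ n) (α : ℝ) (hα : α ∈ Ico (0:ℝ) 1)
    (E0 E1 : ℝ → ℝ)
    (hd0 : ErnstData n α (fun x => (E0 x : ℂ)))
    (hd1 : ErnstData n α (fun y => (E1 y : ℂ)))
    (hpos0 : ∀ x ∈ Ico (0:ℝ) 1, 0 < E0 x)
    (hpos1 : ∀ y ∈ Ico (0:ℝ) 1, 0 < E1 y) :
    ∃ V : ℝ → ℝ → ℝ,
      EDSolution n V (fun x => -Real.log (E0 x)) (fun y => -Real.log (E1 y)) ∧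
      ErnstSolution n (fun x y => ((Real.exp (-(V x y)) : ℝ) : ℂ))
        (fun x => (E0 x : ℂ)) (fun y => (E1 y : ℂ)) := by
  have hn1 : 1 ≤ n := by omega
  obtain ⟨V, Vx, Vy, Vxy, hP, hV⟩ :=
    exists_edSolutionWith hn1 hα (hd0.neg_log hn1) (hd1.neg_log hn1)
  exact ⟨V, ⟨α, hα, hV⟩, α, hα, .of_eulerDarboux hpos0 hpos1 hP hV⟩
end
end
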